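/- arXiv:1407.1750 — 3 statements merged into one kernel-verified Lean document; each statement's English description precedes it below -/
import Mathlib

section
/- Let P be a perfect Lie superalgebra over a commutative unital ring K, i.e. P = [P,P]. Then the homomorphism u : P ⊗ P → P, p ⊗ p′ ↦ [p,p′] (where P ⊗ P is the non-abelian tensor product of P with itself, acting on itself by the adjoint action) is a universal central extension of P: u is surjective with Ker u ⊆ Z(P ⊗ P), and for any central extension f : M ↠ P (surjective homomorphism with Ker f ⊆ Z(M)) there is a unique Lie superalgebra homomorphism θ : P ⊗ P → M with f ∘ θ = u. -/
open scoped TensorProduct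

namespace SuperNA

/-- The sign `(-1)^(|α||β|)` appearing in super-algebra identities. -/
def ssign (α β : ZMod 2) : ℤ := (-1 : ℤ) ^ (α.val * β.val)

/-- A Lie superalgebra over a commutative unital ring `K`: a `ℤ/2`-graded `K`-module
with a bilinear bracket satisfying the graded skew-symmetry, the graded Jacobi
(Leibniz form) identity, and `[x₀,x₀] = 0` for even `x₀`. -/
structure LieSuperalgebra (K : Type) [CommRing K] : Type 1 where
  carrier : Type
  [isAddCommGroup : AddCommGroup carrier]
  [isModule : Module K carrier]
  grading : ZMod 2 → Submodule K carrier
  isInternal : DirectSum.IsInternal grading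
  bracket : carrier →ₗ[K] carrier →ₗ[K] carrier
  bracket_grading : ∀ (α β : ZMod 2) (x y : carrier),
    x ∈ grading α → y ∈ grading β → bracket x y ∈ grading (α + β)
  super_skew : ∀ (α β : ZMod 2) (x y : carrier), x ∈ grading α → y ∈ grading β →
    bracket x y = -(ssign α β • bracket y x)
  super_jacobi : ∀ (α β : ZMod 2) (x y : carrier), x ∈ grading α → y ∈ grading β →
    ∀ z : carrier, bracket x (bracket y z)
      = bracket (bracket x y) z + ssign α β • bracket y (bracket x z)
  bracket_self_even : ∀ x ∈ grading 0, bracket x x = 0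

attribute [instance] LieSuperalgebra.isAddCommGroup LieSuperalgebra.isModule

variable {K : Type} [CommRing K]

instance : CoeSort (LieSuperalgebra K) Type := ⟨LieSuperalgebra.carrier⟩

/-- A homomorphism of Lie superalgebras: an even linear map preserving brackets. -/
structure LieSuperHom (L M : LieSuperalgebra K) where
  toLinear : L.carrier →ₗ[K] M.carrier
  map_grading : ∀ (α : ZMod 2), ∀ x ∈ L.grading α, toLinear x ∈ M.grading α
  map_bracket : ∀ x y, toLinear (L.bracket x y) = M.bracket (toLinear x) (toLinear y)

/-- An action of the Lie superalgebra `P` on the Lie superalgebra `M`. -/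
structure LieSuperAction (P M : LieSuperalgebra K) where
  act : P.carrier →ₗ[K] M.carrier →ₗ[K] M.carrier
  act_grading : ∀ (α β : ZMod 2) (p : P.carrier) (m : M.carrier),
    p ∈ P.grading α → m ∈ M.grading β → act p m ∈ M.grading (α + β)
  act_bracket : ∀ (α β : ZMod 2) (p p' : P.carrier), p ∈ P.grading α → p' ∈ P.grading β →
    ∀ m : M.carrier, act (P.bracket p p') m = act p (act p' m) - ssign α β • act p' (act p m)
  act_super_der : ∀ (α β : ZMod 2) (p : P.carrier) (m : M.carrier),
    p ∈ P.grading α → m ∈ M.grading β → ∀ m' : M.carrier,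
    act p (M.bracket m m') = M.bracket (act p m) m' + ssign α β • M.bracket m (act p m')

/-- Two mutual actions are compatible. -/
structure AreCompatible {M N : LieSuperalgebra K}
    (aMN : LieSuperAction M N) (aNM : LieSuperAction N M) : Prop where
  compat_left : ∀ (α β : ZMod 2) (m : M.carrier) (n : N.carrier),
    m ∈ M.grading α → n ∈ N.grading β → ∀ n' : N.carrier,
    aMN.act (aNM.act n m) n' = -(ssign α β • N.bracket (aMN.act m n) n')
  compat_right : ∀ (α β : ZMod 2) (m : M.carrier) (n : N.carrier),
    m ∈ M.grading α → n ∈ N.grading β → ∀ m' : M.carrier,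
    aNM.act (aMN.act m n) m' = -(ssign α β • M.bracket (aNM.act n m) m')

/-- A crossed module of Lie superalgebras `∂ : M → P`. -/
structure CrossedModule (M P : LieSuperalgebra K) where
  act : LieSuperAction P M
  d : LieSuperHom M P
  cm_act : ∀ (p : P.carrier) (m : M.carrier), d.toLinear (act.act p m) = P.bracket p (d.toLinear m)
  cm_peiffer : ∀ (m m' : M.carrier), act.act (d.toLinear m) m' = M.bracket m m'

/-- A morphism of crossed `P`-modules. -/
structure CMHom {P M N : LieSuperalgebra K} (cmM : CrossedModule M P) (cmN : CrossedModule N P) where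
  hom : LieSuperHom M N
  equivariant : ∀ (p : P.carrier) (m : M.carrier),
    hom.toLinear (cmM.act.act p m) = cmN.act.act p (hom.toLinear m)
  comm : ∀ m : M.carrier, cmN.d.toLinear (hom.toLinear m) = cmM.d.toLinear m

/-- The data of a family of "tensor symbols" in a Lie superalgebra `Q`, indexed by pairs of
homogeneous elements of `M` and `N`, satisfying the defining relations of the non-abelian
tensor product `M ⊗ N`. -/
structure TensorData {M N : LieSuperalgebra K}
    (aMN : LieSuperAction M N) (aNM : LieSuperAction N M) (Q : LieSuperalgebra K) where
  pair : (α β : ZMod 2) → M.grading α → N.grading β → Q.carrier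
  pair_grading : ∀ (α β : ZMod 2) (m : M.grading α) (n : N.grading β),
    pair α β m n ∈ Q.grading (α + β)
  pair_smul_left : ∀ (α β : ZMod 2) (c : K) (m : M.grading α) (n : N.grading β),
    pair α β (c • m) n = c • pair α β m n
  pair_smul_right : ∀ (α β : ZMod 2) (c : K) (m : M.grading α) (n : N.grading β),
    pair α β m (c • n) = c • pair α β m n
  pair_add_left : ∀ (α β : ZMod 2) (m m' : M.grading α) (n : N.grading β),
    pair α β (m + m') n = pair α β m n + pair α β m' n
  pair_add_right : ∀ (α β : ZMod 2) (m : M.grading α) (n n' : N.grading β),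
    pair α β m (n + n') = pair α β m n + pair α β m n'
  pair_bracket_left : ∀ (α α' β : ZMod 2) (m : M.grading α) (m' : M.grading α') (n : N.grading β),
    pair (α + α') β ⟨M.bracket m.1 m'.1, M.bracket_grading α α' m.1 m'.1 m.2 m'.2⟩ n
      = pair α (α' + β) m ⟨aMN.act m'.1 n.1, aMN.act_grading α' β m'.1 n.1 m'.2 n.2⟩
        - ssign α α' • pair α' (α + β) m' ⟨aMN.act m.1 n.1, aMN.act_grading α β m.1 n.1 m.2 n.2⟩
  pair_bracket_right : ∀ (α β β' : ZMod 2) (m : M.grading α) (n : N.grading β) (n' : N.grading β'),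
    pair α (β + β') m ⟨N.bracket n.1 n'.1, N.bracket_grading β β' n.1 n'.1 n.2 n'.2⟩
      = ssign β' (α + β) • pair (β' + α) β
          ⟨aNM.act n'.1 m.1, aNM.act_grading β' α n'.1 m.1 n'.2 m.2⟩ n
        - ssign α β • pair (β + α) β'
          ⟨aNM.act n.1 m.1, aNM.act_grading β α n.1 m.1 n.2 m.2⟩ n'
  pair_bracket_pair : ∀ (α β α' β' : ZMod 2) (m : M.grading α) (n : N.grading β)
      (m' : M.grading α') (n' : N.grading β'),
    Q.bracket (pair α β m n) (pair α' β' m' n')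
      = -(ssign α β • pair (β + α) (α' + β')
          ⟨aNM.act n.1 m.1, aNM.act_grading β α n.1 m.1 n.2 m.2⟩
          ⟨aMN.act m'.1 n'.1, aMN.act_grading α' β' m'.1 n'.1 m'.2 n'.2⟩)

/-- `(T, ι)` is *the* non-abelian tensor product `M ⊗ N`: it is initial among Lie
superalgebras equipped with tensor symbols satisfying the defining relations.  This
universal property characterizes the Lie superalgebra presented by the generators
`m ⊗ n` and the relations of the non-abelian tensor product, uniquely up to isomorphism. -/
def IsNATensor {M N : LieSuperalgebra K} (aMN : LieSuperAction M N) (aNM : LieSuperAction N M)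
    (T : LieSuperalgebra K) (ι : TensorData aMN aNM T) : Prop :=
  ∀ (Q : LieSuperalgebra K) (d : TensorData aMN aNM Q),
    ∃! f : LieSuperHom T Q,
      ∀ (α β : ZMod 2) (m : M.grading α) (n : N.grading β),
        f.toLinear (ι.pair α β m n) = d.pair α β m n

/-- Tensor-symbol data additionally satisfying the relations of the non-abelian
exterior square `L ∧ L` (relative to an action `a` of `L` on itself). -/
structure ExtSqData {L : LieSuperalgebra K} (a : LieSuperAction L L) (Q : LieSuperalgebra K)
    extends TensorData a a Q where
  pair_alt : ∀ (α β : ZMod 2) (x : L.grading α) (y : L.grading β),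
    toTensorData.pair α β x y + ssign α β • toTensorData.pair β α y x = 0
  pair_self : ∀ x : L.grading 0, toTensorData.pair 0 0 x x = 0

/-- `(E, ι)` is the non-abelian exterior square `L ∧ L`. -/
def IsNAExtSq {L : LieSuperalgebra K} (a : LieSuperAction L L) (E : LieSuperalgebra K)
    (ι : ExtSqData a E) : Prop :=
  ∀ (Q : LieSuperalgebra K) (d : ExtSqData a Q),
    ∃! f : LieSuperHom E Q,
      ∀ (α β : ZMod 2) (x : L.grading α) (y : L.grading β),
        f.toLinear (ι.pair α β x y) = d.pair α β x y

/-- Generating family for a free Lie superalgebra on a graded set. -/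
structure FreeData (X : Type) (degX : X → ZMod 2) (F : LieSuperalgebra K) where
  gen : X → F.carrier
  gen_grading : ∀ x, gen x ∈ F.grading (degX x)

/-- `F` (with generators `i`) is the free Lie superalgebra on the graded set `(X, degX)`. -/
def IsFreeLieSuper {X : Type} (degX : X → ZMod 2) (F : LieSuperalgebra K)
    (i : FreeData X degX F) : Prop :=
  ∀ (M : LieSuperalgebra K) (j : FreeData X degX M),
    ∃! h : LieSuperHom F M, ∀ x, h.toLinear (i.gen x) = j.gen x

/-- The submodule spanned by brackets `[S, T]`. -/
def bracketSpan (L : LieSuperalgebra K) (S T : Submodule K L.carrier) :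
    Submodule K L.carrier :=
  Submodule.span K {z | ∃ x ∈ S, ∃ y ∈ T, z = L.bracket x y}

/-- Lower central series of a (sub-)Lie superalgebra `S ⊆ L`: `lcs 0 = S`,
`lcs (n+1) = [S, lcs n]`.  `S` is nilpotent of class `≤ c` iff `lcs c = ⊥`. -/
def lcs (L : LieSuperalgebra K) (S : Submodule K L.carrier) : ℕ → Submodule K L.carrier
  | 0 => S
  | n + 1 => bracketSpan L S (lcs L S n)

/-- Derived series of `S ⊆ L`.  `S` is solvable of derived length `≤ c` iff `ds c = ⊥`. -/
def ds (L : LieSuperalgebra K) (S : Submodule K L.carrier) : ℕ → Submodule K L.carrier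
  | 0 => S
  | n + 1 => bracketSpan L (ds L S n) (ds L S n)

/-- `S ⊆ L` is `n`-Engel: `ad(x)ⁿ = 0` on `S` for every `x ∈ S`. -/
def IsEngel (L : LieSuperalgebra K) (S : Submodule K L.carrier) (n : ℕ) : Prop :=
  ∀ x ∈ S, ∀ y ∈ S, ((L.bracket x) ^ n) y = 0

section Grading

variable {V W : Type} [AddCommGroup V] [Module K V] [AddCommGroup W] [Module K W]

/-- The induced grading on a submodule. -/
def gradeSub (g : ZMod 2 → Submodule K V) (S : Submodule K V) : ZMod 2 → Submodule K S :=
  fun α => (g α).comap S.subtype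

/-- The induced grading on a quotient module. -/
def gradeQuot (g : ZMod 2 → Submodule K V) (S : Submodule K V) : ZMod 2 → Submodule K (V ⧸ S) :=
  fun α => (g α).map S.mkQ

/-- The induced grading on a tensor product of supermodules. -/
def gradeTensor (gV : ZMod 2 → Submodule K V) (gW : ZMod 2 → Submodule K W) :
    ZMod 2 → Submodule K (V ⊗[K] W) :=
  fun γ => Submodule.span K {t | ∃ (α β : ZMod 2) (v : V) (w : W),
    α + β = γ ∧ v ∈ gV α ∧ w ∈ gW β ∧ t = v ⊗ₜ[K] w}

/-- A linear equivalence is an isomorphism of supermodules for the given gradings. -/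
def SuperEquiv (gV : ZMod 2 → Submodule K V) (gW : ZMod 2 → Submodule K W)
    (e : V ≃ₗ[K] W) : Prop :=
  ∀ α, (gV α).map e.toLinearMap = gW α

end Grading

/-- An associative (unital) superalgebra over `K`. -/
structure AssocSuperalgebra (K : Type) [CommRing K] : Type 1 where
  carrier : Type
  [isRing : Ring carrier]
  [isAlgebra : Algebra K carrier]
  grading : ZMod 2 → Submodule K carrier
  isInternal : DirectSum.IsInternal grading
  grading_mul : ∀ (α β : ZMod 2) (x y : carrier),
    x ∈ grading α → y ∈ grading β → x * y ∈ grading (α + β)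
  one_mem : (1 : carrier) ∈ grading 0

attribute [instance] AssocSuperalgebra.isRing AssocSuperalgebra.isAlgebra

/-- A (not necessarily unital) associative superalgebra over `K`. -/
structure NuAssocSuperalgebra (K : Type) [CommRing K] : Type 1 where
  carrier : Type
  [isRing : NonUnitalRing carrier]
  [isModule : Module K carrier]
  [isTower : IsScalarTower K carrier carrier]
  [isComm : SMulCommClass K carrier carrier]
  grading : ZMod 2 → Submodule K carrier
  isInternal : DirectSum.IsInternal grading
  grading_mul : ∀ (α β : ZMod 2) (x y : carrier),
    x ∈ grading α → y ∈ grading β → x * y ∈ grading (α + β)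

attribute [instance] NuAssocSuperalgebra.isRing NuAssocSuperalgebra.isModule
  NuAssocSuperalgebra.isTower NuAssocSuperalgebra.isComm

/-- The super-alternating relations inside `L ⊗ L`, whose quotient is `Λ²(L)`. -/
def altRel (L : LieSuperalgebra K) : Submodule K (L.carrier ⊗[K] L.carrier) :=
  Submodule.span K {t | ∃ (α β : ZMod 2) (x : L.grading α) (y : L.grading β),
    t = x.1 ⊗ₜ[K] y.1 + ssign α β • (y.1 ⊗ₜ[K] x.1)}

/-- The super-alternating relations inside `L ⊗ (L ⊗ L)`, whose quotient is `Λ³(L)`. -/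
def altRel3 (L : LieSuperalgebra K) :
    Submodule K (L.carrier ⊗[K] (L.carrier ⊗[K] L.carrier)) :=
  Submodule.span K
    ({t | ∃ (x : L.carrier) (r : L.carrier ⊗[K] L.carrier), r ∈ altRel L ∧ t = x ⊗ₜ[K] r} ∪
     {t | ∃ (α β : ZMod 2) (x : L.grading α) (y : L.grading β) (z : L.carrier),
        t = x.1 ⊗ₜ[K] (y.1 ⊗ₜ[K] z) + ssign α β • (y.1 ⊗ₜ[K] (x.1 ⊗ₜ[K] z))})

theorem ssign_mul_ssign_add_mul_ssign (α β γ : ZMod 2) :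
    ssign α β * ssign β (α + γ) * ssign α γ = ssign γ (α + β) := by
  revert α β γ; decide

theorem univ_zmod_two : (Set.univ : Set (ZMod 2)) = {0, 1} := by
  ext a
  revert a
  simp only [Set.mem_univ, Set.mem_insert_iff, Set.mem_singleton_iff, true_iff]
  decide

namespace LieSuperalgebra

variable (L : LieSuperalgebra K)

/-- The projection of a Lie superalgebra onto a homogeneous component. -/
noncomputable def proj (α : ZMod 2) : L.carrier →ₗ[K] L.grading α :=
  DirectSum.component K (ZMod 2) (fun i => L.grading i) α ∘ₗ
    (LinearEquiv.ofBijective (DirectSum.coeLinearMap L.grading) L.isInternal).symm.toLinearMap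

theorem proj_coe (α : ZMod 2) (x : L.grading α) : L.proj α x.1 = x :=
  L.isInternal.ofBijective_coeLinearMap_same x

theorem proj_coe_of_ne {α β : ZMod 2} (h : α ≠ β) (x : L.grading α) : L.proj β x.1 = 0 :=
  L.isInternal.ofBijective_coeLinearMap_of_ne h x

variable {L}

theorem mem_of_homogeneous {S : Submodule K L.carrier} (h : ∀ α, L.grading α ≤ S)
    (x : L.carrier) : x ∈ S := by
  have hS : (⊤ : Submodule K L.carrier) ≤ S :=
    L.isInternal.submodule_iSup_eq_top ▸ iSup_le h
  exact hS trivial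

theorem linearMap_ext {V : Type*} [AddCommGroup V] [Module K V] {f g : L.carrier →ₗ[K] V}
    (h : ∀ α, ∀ x ∈ L.grading α, f x = g x) : f = g :=
  LinearMap.ext fun x => mem_of_homogeneous (S := LinearMap.eqLocus f g) h x

theorem linearMap_ext₂ {L' : LieSuperalgebra K} {V : Type*} [AddCommGroup V] [Module K V]
    {f g : L.carrier →ₗ[K] L'.carrier →ₗ[K] V}
    (h : ∀ α β, ∀ x ∈ L.grading α, ∀ y ∈ L'.grading β, f x y = g x y) : f = g :=
  linearMap_ext fun α x hx => linearMap_ext fun β y hy => h α β x hx y hy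

theorem exists_add_eq (x : L.carrier) : ∃ a ∈ L.grading 0, ∃ b ∈ L.grading 1, a + b = x :=
  Submodule.mem_sup.1 <| mem_of_homogeneous (S := L.grading 0 ⊔ L.grading 1)
    (fun α => by
      have hα : α ∈ ({0, 1} : Set (ZMod 2)) := univ_zmod_two ▸ Set.mem_univ α
      rcases hα with rfl | rfl
      exacts [le_sup_left, le_sup_right]) x

theorem isCompl_grading : IsCompl (L.grading 0) (L.grading 1) :=
  L.isInternal.isCompl zero_ne_one univ_zmod_two

/-- The sub-superalgebra on a graded submodule closed under the bracket. -/
def sub (L : LieSuperalgebra K) (S : Submodule K L.carrier)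
    (hS : ∀ x ∈ S, ∀ y ∈ S, L.bracket x y ∈ S)
    (hg : ∀ x ∈ S, ∃ a ∈ S, a ∈ L.grading 0 ∧ ∃ b ∈ S, b ∈ L.grading 1 ∧ a + b = x) :
    LieSuperalgebra K where
  carrier := S
  grading := gradeSub L.grading S
  isInternal := by
    rw [DirectSum.isInternal_submodule_iff_isCompl _ zero_ne_one univ_zmod_two]
    constructor
    · rw [Submodule.disjoint_def]
      intro x h0 h1
      exact Subtype.ext (Submodule.disjoint_def.1 isCompl_grading.disjoint x.1 h0 h1)
    · rw [codisjoint_iff, eq_top_iff]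
      rintro ⟨x, hx⟩ -
      obtain ⟨a, ha, ha0, b, hb, hb1, hab⟩ := hg x hx
      exact Submodule.mem_sup.2 ⟨⟨a, ha⟩, ha0, ⟨b, hb⟩, hb1, Subtype.ext hab⟩
  bracket := LinearMap.mk₂ K (fun x y => ⟨L.bracket x.1 y.1, hS _ x.2 _ y.2⟩)
    (fun x y z => Subtype.ext (by simp)) (fun c x y => Subtype.ext (by simp))
    (fun x y z => Subtype.ext (by simp)) (fun c x y => Subtype.ext (by simp))
  bracket_grading α β x y hx hy := L.bracket_grading α β x.1 y.1 hx hy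
  super_skew α β x y hx hy := Subtype.ext (L.super_skew α β x.1 y.1 hx hy)
  super_jacobi α β x y hx hy z := Subtype.ext (L.super_jacobi α β x.1 y.1 hx hy z.1)
  bracket_self_even x hx := Subtype.ext (L.bracket_self_even x.1 hx)

end LieSuperalgebra

namespace LieSuperHom

variable {L M N : LieSuperalgebra K}

theorem ext {f g : LieSuperHom L M} (h : f.toLinear = g.toLinear) : f = g := by
  cases f; cases g; cases h; rfl

theorem exists_homogeneous_lift (f : LieSuperHom L M) (hf : Function.Surjective f.toLinear)
    (α : ZMod 2) (y : M.carrier) (hy : y ∈ M.grading α) :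
    ∃ x ∈ L.grading α, f.toLinear x = y := by
  have key : ∀ x, f.toLinear (L.proj α x).1 = (M.proj α (f.toLinear x)).1 := by
    intro x
    refine LinearMap.congr_fun (LieSuperalgebra.linearMap_ext
      (f := f.toLinear ∘ₗ (L.grading α).subtype ∘ₗ L.proj α)
      (g := (M.grading α).subtype ∘ₗ M.proj α ∘ₗ f.toLinear) fun β z hz => ?_) x
    have hz' := f.map_grading β z hz
    by_cases h : β = α
    · subst h
      simp [L.proj_coe β ⟨z, hz⟩, M.proj_coe β ⟨_, hz'⟩]
    · simp [L.proj_coe_of_ne h ⟨z, hz⟩, M.proj_coe_of_ne h ⟨_, hz'⟩]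
  obtain ⟨x, rfl⟩ := hf y
  exact ⟨_, (L.proj α x).2, by rw [key, M.proj_coe α ⟨_, hy⟩]⟩

theorem bracket_eq_zero_right (f : LieSuperHom L M)
    (hc : ∀ x, f.toLinear x = 0 → ∀ y, L.bracket x y = 0) (x y : L.carrier)
    (hx : f.toLinear x = 0) : L.bracket y x = 0 := by
  obtain ⟨a, ha, b, hb, rfl⟩ := L.exists_add_eq x
  have hab : f.toLinear a = -f.toLinear b := by
    rwa [map_add, add_eq_zero_iff_eq_neg] at hx
  have ha0 : f.toLinear a = 0 :=
    Submodule.disjoint_def.1 M.isCompl_grading.disjoint _ (f.map_grading 0 a ha)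
      (hab ▸ neg_mem (f.map_grading 1 b hb))
  have hb0 : f.toLinear b = 0 := by simpa [ha0] using hab.symm
  refine LinearMap.congr_fun (LieSuperalgebra.linearMap_ext (f := L.bracket.flip (a + b)) (g := 0)
    fun β z hz => ?_) y
  simp [L.super_skew β 0 z a hz ha, L.super_skew β 1 z b hz hb, hc a ha0, hc b hb0]

theorem bracket_congr (f : LieSuperHom L M)
    (hc : ∀ x, f.toLinear x = 0 → ∀ y, L.bracket x y = 0) {x x' y y' : L.carrier}
    (hx : f.toLinear x = f.toLinear x') (hy : f.toLinear y = f.toLinear y') :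
    L.bracket x y = L.bracket x' y' := by
  have h1 := hc (x - x') (by simp [hx]) y
  have h2 := f.bracket_eq_zero_right hc (y - y') x' (by simp [hy])
  rw [map_sub, LinearMap.sub_apply, sub_eq_zero] at h1
  rw [map_sub, sub_eq_zero] at h2
  exact h1.trans h2

/-- The bilinear map `P × P → M` induced by the bracket of a central extension `M` of `P`. -/
noncomputable def liftBracket (f : LieSuperHom M N) (hf : Function.Surjective f.toLinear)
    (hc : ∀ x, f.toLinear x = 0 → ∀ y, M.bracket x y = 0) :
    N.carrier →ₗ[K] N.carrier →ₗ[K] M.carrier :=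
  have hs := Function.surjInv_eq hf
  LinearMap.mk₂ K
    (fun x y => M.bracket (Function.surjInv hf x) (Function.surjInv hf y))
    (fun x y z => by
      rw [← LinearMap.add_apply, ← map_add]; exact f.bracket_congr hc (by simp [hs]) rfl)
    (fun c x y => by
      rw [← LinearMap.smul_apply, ← map_smul]; exact f.bracket_congr hc (by simp [hs]) rfl)
    (fun x y z => by
      rw [← map_add]; exact f.bracket_congr hc rfl (by simp [hs]))
    (fun c x y => by
      rw [← map_smul]; exact f.bracket_congr hc rfl (by simp [hs]))

theorem liftBracket_apply (f : LieSuperHom M N) (hf : Function.Surjective f.toLinear)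
    (hc : ∀ x, f.toLinear x = 0 → ∀ y, M.bracket x y = 0) (x y : M.carrier) :
    f.liftBracket hf hc (f.toLinear x) (f.toLinear y) = M.bracket x y :=
  f.bracket_congr hc (Function.surjInv_eq hf _) (Function.surjInv_eq hf _)

end LieSuperHom

namespace TensorData

section

variable {M N Q : LieSuperalgebra K} {aMN : LieSuperAction M N} {aNM : LieSuperAction N M}

/-- The bilinear extension of the tensor symbols to all elements. -/
noncomputable def bilin (d : TensorData aMN aNM Q) :
    M.carrier →ₗ[K] N.carrier →ₗ[K] Q.carrier :=
  ∑ α, ∑ β, (LinearMap.mk₂ K (d.pair α β) (d.pair_add_left α β) (d.pair_smul_left α β)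
    (d.pair_add_right α β) (d.pair_smul_right α β)).compl₁₂ (M.proj α) (N.proj β)

theorem bilin_apply (d : TensorData aMN aNM Q) {α β : ZMod 2} {m : M.carrier} {n : N.carrier}
    (hm : m ∈ M.grading α) (hn : n ∈ N.grading β) :
    d.bilin m n = d.pair α β ⟨m, hm⟩ ⟨n, hn⟩ := by
  have h1 := M.proj_coe α ⟨m, hm⟩
  have h2 := N.proj_coe β ⟨n, hn⟩
  simp only [bilin, LinearMap.sum_apply, LinearMap.compl₁₂_apply]
  rw [Finset.sum_eq_single α, Finset.sum_eq_single β]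
  · simp only at h1 h2
    rw [h1, h2, LinearMap.mk₂_apply]
  · intro b _ hb
    rw [N.proj_coe_of_ne hb.symm ⟨n, hn⟩, map_zero]
  · simp
  · intro a _ ha
    simp only [M.proj_coe_of_ne ha.symm ⟨m, hm⟩, map_zero, LinearMap.zero_apply,
      Finset.sum_const_zero]
  · simp

/-- The submodule spanned by the tensor symbols. -/
def pairSpan (d : TensorData aMN aNM Q) : Submodule K Q.carrier :=
  Submodule.span K {z | ∃ (α β : ZMod 2) (m : M.grading α) (n : N.grading β),
    z = d.pair α β m n}

theorem pair_mem_pairSpan (d : TensorData aMN aNM Q) {α β : ZMod 2} (m : M.grading α)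
    (n : N.grading β) : d.pair α β m n ∈ d.pairSpan :=
  Submodule.subset_span ⟨α, β, m, n, rfl⟩

theorem bracket_mem_pairSpan (d : TensorData aMN aNM Q) (x : Q.carrier) (hx : x ∈ d.pairSpan)
    (y : Q.carrier) (hy : y ∈ d.pairSpan) : Q.bracket x y ∈ d.pairSpan := by
  induction hx, hy using Submodule.span_induction₂ with
  | mem_mem x y hx hy =>
    obtain ⟨α, β, m, n, rfl⟩ := hx
    obtain ⟨α', β', m', n', rfl⟩ := hy
    rw [d.pair_bracket_pair]
    exact neg_mem (zsmul_mem (d.pair_mem_pairSpan _ _) _)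
  | zero_left y hy => simp
  | zero_right x hx => simp
  | add_left x y z _ _ _ h1 h2 => simpa using add_mem h1 h2
  | add_right x y z _ _ _ h1 h2 => simpa using add_mem h1 h2
  | smul_left r x y _ _ h => simpa using Submodule.smul_mem _ r h
  | smul_right r x y _ _ h => simpa using Submodule.smul_mem _ r h

theorem exists_homogeneous_add_eq (d : TensorData aMN aNM Q) (x : Q.carrier)
    (hx : x ∈ d.pairSpan) :
    ∃ a ∈ d.pairSpan, a ∈ Q.grading 0 ∧ ∃ b ∈ d.pairSpan, b ∈ Q.grading 1 ∧ a + b = x := by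
  induction hx using Submodule.span_induction with
  | mem x hx =>
    obtain ⟨α, β, m, n, rfl⟩ := hx
    have hg := d.pair_grading α β m n
    have hαβ : α + β ∈ ({0, 1} : Set (ZMod 2)) := univ_zmod_two ▸ Set.mem_univ _
    rcases hαβ with h | h
    · exact ⟨_, d.pair_mem_pairSpan m n, h ▸ hg, 0, zero_mem _, zero_mem _, add_zero _⟩
    · refine ⟨0, zero_mem _, zero_mem _, _, d.pair_mem_pairSpan m n, ?_, zero_add _⟩
      rw [Set.mem_singleton_iff] at h
      exact h ▸ hg
  | zero => exact ⟨0, zero_mem _, zero_mem _, 0, zero_mem _, zero_mem _, add_zero _⟩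
  | add x y _ _ hx hy =>
    obtain ⟨a, ha, ha0, b, hb, hb1, rfl⟩ := hx
    obtain ⟨c, hc, hc0, e, he, he1, rfl⟩ := hy
    exact ⟨a + c, add_mem ha hc, add_mem ha0 hc0, b + e, add_mem hb he, add_mem hb1 he1,
      add_add_add_comm a c b e⟩
  | smul r x _ hx =>
    obtain ⟨a, ha, ha0, b, hb, hb1, rfl⟩ := hx
    exact ⟨r • a, Submodule.smul_mem _ r ha, Submodule.smul_mem _ r ha0, r • b,
      Submodule.smul_mem _ r hb, Submodule.smul_mem _ r hb1, (smul_add r a b).symm⟩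

/-- The tensor symbols, viewed in the sub-superalgebra which they span. -/
def restrict (d : TensorData aMN aNM Q) :
    TensorData aMN aNM (Q.sub d.pairSpan d.bracket_mem_pairSpan d.exists_homogeneous_add_eq) where
  pair α β m n := ⟨d.pair α β m n, d.pair_mem_pairSpan m n⟩
  pair_grading α β m n := d.pair_grading α β m n
  pair_smul_left α β c m n := Subtype.ext (d.pair_smul_left α β c m n)
  pair_smul_right α β c m n := Subtype.ext (d.pair_smul_right α β c m n)
  pair_add_left α β m m' n := Subtype.ext (d.pair_add_left α β m m' n)
  pair_add_right α β m n n' := Subtype.ext (d.pair_add_right α β m n n')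
  pair_bracket_left α α' β m m' n := Subtype.ext (d.pair_bracket_left α α' β m m' n)
  pair_bracket_right α β β' m n n' := Subtype.ext (d.pair_bracket_right α β β' m n n')
  pair_bracket_pair α β α' β' m n m' n' :=
    Subtype.ext (d.pair_bracket_pair α β α' β' m n m' n')

/-- The non-abelian tensor product is spanned by the tensor symbols. -/
theorem pairSpan_eq_top {d : TensorData aMN aNM Q} (h : IsNATensor aMN aNM Q d) :
    d.pairSpan = ⊤ := by
  obtain ⟨f, hf, -⟩ := h _ d.restrict
  let g : LieSuperHom Q Q :=
    { toLinear := d.pairSpan.subtype ∘ₗ f.toLinear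
      map_grading := fun α x hx => f.map_grading α x hx
      map_bracket := fun x y => congrArg Subtype.val (f.map_bracket x y) }
  let i : LieSuperHom Q Q :=
    { toLinear := LinearMap.id
      map_grading := fun _ _ hx => hx
      map_bracket := fun _ _ => rfl }
  have hgi : g = i := (h Q d).unique
    (fun α β m n => congrArg Subtype.val (hf α β m n)) (fun _ _ _ _ => rfl)
  rw [eq_top_iff]
  intro x _
  have hx : (f.toLinear x).1 = x := congrArg (fun k => k.toLinear x) hgi
  exact hx ▸ (f.toLinear x).2

theorem linearMap_ext {d : TensorData aMN aNM Q} (h : IsNATensor aMN aNM Q d) {V : Type*}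
    [AddCommGroup V] [Module K V] {f g : Q.carrier →ₗ[K] V}
    (hfg : ∀ (α β : ZMod 2) (m : M.grading α) (n : N.grading β),
      f (d.pair α β m n) = g (d.pair α β m n)) : f = g := by
  refine LinearMap.ext_on (pairSpan_eq_top h) ?_
  rintro _ ⟨α, β, m, n, rfl⟩
  exact hfg α β m n

end

section

variable {P M : LieSuperalgebra K} {ad : LieSuperAction P P}

/-- The tensor symbols `p ⊗ p' ↦ [x, x']` in a central extension `M` of `P`, where `x` and `x'`
are lifts of `p` and `p'`. -/
noncomputable def ofCentralExtension (had : ∀ p q : P.carrier, ad.act p q = P.bracket p q)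
    (f : LieSuperHom M P) (hf : Function.Surjective f.toLinear)
    (hc : ∀ x, f.toLinear x = 0 → ∀ y, M.bracket x y = 0) : TensorData ad ad M where
  pair α β p q := f.liftBracket hf hc p.1 q.1
  pair_grading := by
    rintro α β ⟨p, hp⟩ ⟨q, hq⟩
    obtain ⟨x, hx, rfl⟩ := f.exists_homogeneous_lift hf α p hp
    obtain ⟨y, hy, rfl⟩ := f.exists_homogeneous_lift hf β q hq
    rw [f.liftBracket_apply]
    exact M.bracket_grading α β x y hx hy
  pair_smul_left α β c p q := by simp
  pair_smul_right α β c p q := by simp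
  pair_add_left α β p p' q := by simp
  pair_add_right α β p q q' := by simp
  pair_bracket_left := by
    rintro α α' β ⟨p, hp⟩ ⟨p', hp'⟩ ⟨q, hq⟩
    obtain ⟨x, hx, rfl⟩ := f.exists_homogeneous_lift hf α p hp
    obtain ⟨x', hx', rfl⟩ := f.exists_homogeneous_lift hf α' p' hp'
    obtain ⟨y, rfl⟩ := hf q
    simp only [had, ← f.map_bracket, f.liftBracket_apply]
    rw [M.super_jacobi α α' x x' hx hx', add_sub_cancel_right]
  pair_bracket_right := by
    rintro α β β' ⟨p, hp⟩ ⟨q, hq⟩ ⟨q', hq'⟩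
    obtain ⟨x, hx, rfl⟩ := f.exists_homogeneous_lift hf α p hp
    obtain ⟨y, hy, rfl⟩ := f.exists_homogeneous_lift hf β q hq
    obtain ⟨y', hy', rfl⟩ := f.exists_homogeneous_lift hf β' q' hq'
    simp only [had, ← f.map_bracket, f.liftBracket_apply]
    rw [M.super_jacobi α β x y hx hy, M.super_skew α β x y hx hy,
      M.super_skew β (α + β') y _ hy (M.bracket_grading α β' x y' hx hy'),
      M.super_skew α β' x y' hx hy', ← ssign_mul_ssign_add_mul_ssign α β β']
    simp only [map_neg, map_zsmul, LinearMap.neg_apply, LinearMap.smul_apply, smul_neg, neg_neg,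
      smul_smul, mul_assoc]
    abel
  pair_bracket_pair := by
    rintro α β α' β' ⟨p, hp⟩ ⟨q, hq⟩ ⟨p', hp'⟩ ⟨q', hq'⟩
    obtain ⟨x, hx, rfl⟩ := f.exists_homogeneous_lift hf α p hp
    obtain ⟨y, hy, rfl⟩ := f.exists_homogeneous_lift hf β q hq
    obtain ⟨x', rfl⟩ := hf p'
    obtain ⟨y', rfl⟩ := hf q'
    simp only [had, ← f.map_bracket, f.liftBracket_apply]
    rw [M.super_skew α β x y hx hy]
    simp only [map_neg, map_zsmul, LinearMap.neg_apply, LinearMap.smul_apply]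

/-- For the adjoint action, the bracket of `P ⊗ P` factors through `p ⊗ p' ↦ [p, p']`. -/
theorem bracket_eq_bilin {T : LieSuperalgebra K} {ι : TensorData ad ad T}
    (had : ∀ p q : P.carrier, ad.act p q = P.bracket p q) (hT : IsNATensor ad ad T ι)
    {u : LieSuperHom T P}
    (hu : ∀ (α β : ZMod 2) (p : P.grading α) (p' : P.grading β),
      u.toLinear (ι.pair α β p p') = P.bracket p.1 p'.1) (s t : T.carrier) :
    T.bracket s t = ι.bilin (u.toLinear s) (u.toLinear t) := by
  suffices h : T.bracket = ι.bilin.compl₁₂ u.toLinear u.toLinear by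
    rw [h, LinearMap.compl₁₂_apply]
  refine linearMap_ext hT fun α β m n => linearMap_ext hT fun α' β' m' n' => ?_
  rw [LinearMap.compl₁₂_apply, hu, hu, ι.pair_bracket_pair, ← bilin_apply, had, had,
    P.super_skew α β _ _ m.2 n.2]
  simp only [map_neg, map_zsmul, LinearMap.neg_apply, LinearMap.smul_apply]

end

end TensorData

/-- If `P` is a perfect Lie superalgebra then
`u : P ⊗ P → P`, `p ⊗ p′ ↦ [p,p′]` is a universal central extension of `P`. -/
theorem statement8 {K : Type} [CommRing K] (P : LieSuperalgebra K)
    -- `P` acts on itself by the adjoint action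
    (ad : LieSuperAction P P) (had : ∀ p q : P.carrier, ad.act p q = P.bracket p q)
    -- `P` is perfect
    (hperf : bracketSpan P ⊤ ⊤ = ⊤)
    -- `(T, ι)` is the non-abelian tensor product `P ⊗ P`
    (T : LieSuperalgebra K) (ι : TensorData ad ad T) (hT : IsNATensor ad ad T ι)
    -- `u : P ⊗ P → P` is given on generators by `p ⊗ p′ ↦ [p, p′]`
    (u : LieSuperHom T P)
    (hu : ∀ (α β : ZMod 2) (p : P.grading α) (p' : P.grading β),
      u.toLinear (ι.pair α β p p') = P.bracket p.1 p'.1) :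
    -- `u` is surjective,
    Function.Surjective u.toLinear ∧
    -- `u` is a central extension, i.e. `Ker u ⊆ Z(P ⊗ P)`,
    (∀ x : T.carrier, u.toLinear x = 0 → ∀ t : T.carrier, T.bracket x t = 0) ∧
    -- and `u` is universal: every central extension of `P` receives a unique
    -- homomorphism from it over `P`
    (∀ (M : LieSuperalgebra K) (f : LieSuperHom M P),
      Function.Surjective f.toLinear →
      (∀ x : M.carrier, f.toLinear x = 0 → ∀ y : M.carrier, M.bracket x y = 0) →
      ∃! θ : LieSuperHom T M, ∀ t : T.carrier, f.toLinear (θ.toLinear t) = u.toLinear t) := by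
  have hB : ∀ p q, u.toLinear (ι.bilin p q) = P.bracket p q := fun p q =>
    LinearMap.congr_fun₂ (LieSuperalgebra.linearMap_ext₂ (f := ι.bilin.compr₂ u.toLinear)
      (g := P.bracket) fun α β x hx y hy => by
        rw [LinearMap.compr₂_apply, ι.bilin_apply hx hy, hu]) p q
  have hbr := TensorData.bracket_eq_bilin had hT hu
  have hsurj : Function.Surjective u.toLinear := by
    rw [← LinearMap.range_eq_top, eq_top_iff, ← hperf, bracketSpan, Submodule.span_le]
    rintro _ ⟨p, -, q, -, rfl⟩
    exact ⟨_, hB p q⟩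
  refine ⟨hsurj, fun x hx t => by rw [hbr, hx, map_zero, LinearMap.zero_apply], ?_⟩
  intro M f hf hc
  obtain ⟨θ, hθ, -⟩ := hT M (TensorData.ofCentralExtension had f hf hc)
  refine ⟨θ, fun t => ?_, fun θ' hθ' => ?_⟩
  · refine LinearMap.congr_fun (TensorData.linearMap_ext hT (f := f.toLinear ∘ₗ θ.toLinear)
      fun α β m n => ?_) t
    obtain ⟨x, hx⟩ := hf m.1
    obtain ⟨y, hy⟩ := hf n.1
    rw [LinearMap.comp_apply, hθ, hu, ← hx, ← hy, ← f.map_bracket, ← f.liftBracket_apply hf hc,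
      hx, hy]
    rfl
  · refine LieSuperHom.ext (TensorData.linearMap_ext hT fun α β m n => ?_)
    obtain ⟨s, hs⟩ := hsurj m.1
    obtain ⟨t, ht⟩ := hsurj n.1
    rw [hθ, ← ι.bilin_apply m.2 n.2, ← hs, ← ht, ← hbr, θ'.map_bracket,
      ← f.liftBracket_apply hf hc, hθ', hθ', hs, ht]
    rfl

end SuperNA
end

section
/- Let the ground ring K be a field, let P be a Lie superalgebra over K, and let M be a P-supermodule, regarded as the crossed P-module (M, 0) (the zero map M → P, with M abelian). Then there are isomorphisms of super vector spaces H̄₀(P,M) ≅ H₀(P,M) and H̄₁(P,M) ≅ H₁(P,M), where H̄ᵢ are the non-abelian homologies and Hᵢ(P,M) are the homologies of the Chevalley–Eilenberg complex of the Lie superalgebra P with coefficients in M. -/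
open scoped TensorProduct

namespace SuperNA

variable {K : Type} [CommRing K]

section Projections

variable {V W : Type} [AddCommGroup V] [Module K V] [AddCommGroup W] [Module K W]

/-- The maps `π 0`, `π 1` are the projections onto the homogeneous components of the
grading `g`. -/
structure IsGradingProj (g : ZMod 2 → Submodule K V) (π : ZMod 2 → V →ₗ[K] V) : Prop where
  mem : ∀ α v, π α v ∈ g α
  fix : ∀ α, ∀ v ∈ g α, π α v = v
  kill : ∀ α β, α ≠ β → ∀ v ∈ g α, π β v = 0
  sum : ∀ v, π 0 v + π 1 v = v

theorem zmod_two_cases (α : ZMod 2) : α = 0 ∨ α = 1 := by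
  revert α; decide

theorem IsGradingProj.isInternal {g : ZMod 2 → Submodule K V} {π : ZMod 2 → V →ₗ[K] V}
    (h : IsGradingProj g π) : DirectSum.IsInternal g := by
  rw [DirectSum.isInternal_submodule_iff_isCompl g (i := 0) (j := 1) (by decide)
    (by ext x; simpa using zmod_two_cases x)]
  refine ⟨?_, ?_⟩
  · rw [Submodule.disjoint_def]
    intro x hx0 hx1
    rw [← h.fix 0 x hx0, h.kill 1 0 (by decide) x hx1]
  · rw [codisjoint_iff, eq_top_iff]
    intro x _
    rw [← h.sum x]
    exact Submodule.add_mem_sup (h.mem 0 x) (h.mem 1 x)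

theorem exists_isGradingProj {g : ZMod 2 → Submodule K V} (h : DirectSum.IsInternal g) :
    ∃ π : ZMod 2 → V →ₗ[K] V, IsGradingProj g π := by
  classical
  let := h.chooseDecomposition
  refine ⟨fun α => (g α).subtype ∘ₗ DirectSum.component K (ZMod 2) (fun i => g i) α ∘ₗ
    (DirectSum.decomposeLinearEquiv g).toLinearMap, ?_, ?_, ?_, ?_⟩
  · intro α v
    simp
  · intro α v hv
    exact DirectSum.decompose_of_mem_same g hv
  · intro α β hαβ v hv
    exact DirectSum.decompose_of_mem_ne g hv hαβ
  · intro v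
    have h2 : (Finset.univ : Finset (ZMod 2)) = {0, 1} := by decide
    have := DirectSum.sum_support_decompose g v
    rw [Finset.sum_subset (Finset.subset_univ _) (by
      intro i _ hi
      simpa using hi), h2, Finset.sum_pair (by decide)] at this
    exact this

/-- To prove an additive predicate it suffices to check homogeneous elements. -/
theorem homogeneous_induction {g : ZMod 2 → Submodule K V} (h : DirectSum.IsInternal g)
    {p : V → Prop} (add : ∀ v w, p v → p w → p (v + w))
    (hom : ∀ α, ∀ v ∈ g α, p v) (v : V) : p v := by
  obtain ⟨π, hπ⟩ := exists_isGradingProj h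
  rw [← hπ.sum v]
  exact add _ _ (hom _ _ (hπ.mem 0 v)) (hom _ _ (hπ.mem 1 v))

theorem tmul_mem_gradeTensor {gV : ZMod 2 → Submodule K V} {gW : ZMod 2 → Submodule K W}
    {α β : ZMod 2} {v : V} {w : W} (hv : v ∈ gV α) (hw : w ∈ gW β) :
    v ⊗ₜ[K] w ∈ gradeTensor gV gW (α + β) :=
  Submodule.subset_span ⟨α, β, v, w, rfl, hv, hw, rfl⟩

theorem IsGradingProj.map_tmul {gV : ZMod 2 → Submodule K V} {gW : ZMod 2 → Submodule K W}
    {π : ZMod 2 → V →ₗ[K] V} {ρ : ZMod 2 → W →ₗ[K] W}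
    (hπ : IsGradingProj gV π) (hρ : IsGradingProj gW ρ) (γ α β : ZMod 2)
    {v : V} {w : W} (hv : v ∈ gV α) (hw : w ∈ gW β) :
    (TensorProduct.map (π 0) (ρ γ) + TensorProduct.map (π 1) (ρ (γ + 1))) (v ⊗ₜ[K] w)
      = if α + β = γ then v ⊗ₜ[K] w else 0 := by
  have key : ∀ δ ε, π δ v ⊗ₜ[K] ρ ε w = if α = δ ∧ β = ε then v ⊗ₜ[K] w else 0 := by
    intro δ ε
    by_cases h1 : α = δ
    · by_cases h2 : β = ε
      · subst h1 h2
        simp [hπ.fix _ v hv, hρ.fix _ w hw]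
      · simp [hρ.kill _ _ h2 w hw, h2]
    · simp [hπ.kill _ _ h1 v hv, h1]
  rw [LinearMap.add_apply, TensorProduct.map_tmul, TensorProduct.map_tmul, key, key]
  have h01 : (0 : ZMod 2) ≠ 1 := by decide
  have h11 : (1 : ZMod 2) + 1 = 0 := by decide
  rcases zmod_two_cases α with rfl | rfl <;> rcases zmod_two_cases β with rfl | rfl <;>
    rcases zmod_two_cases γ with rfl | rfl <;> simp [h01, h11]

theorem IsGradingProj.tensor {gV : ZMod 2 → Submodule K V} {gW : ZMod 2 → Submodule K W}
    {π : ZMod 2 → V →ₗ[K] V} {ρ : ZMod 2 → W →ₗ[K] W}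
    (hπ : IsGradingProj gV π) (hρ : IsGradingProj gW ρ) :
    IsGradingProj (gradeTensor gV gW)
      (fun γ => TensorProduct.map (π 0) (ρ γ) + TensorProduct.map (π 1) (ρ (γ + 1))) := by
  have hγ : ∀ γ : ZMod 2, 1 + (γ + 1) = γ := by decide
  refine ⟨?_, ?_, ?_, ?_⟩
  · intro γ t
    induction t using TensorProduct.induction_on with
    | zero => simp
    | add s t hs ht => rw [map_add]; exact add_mem hs ht
    | tmul v w =>
      rw [LinearMap.add_apply, TensorProduct.map_tmul, TensorProduct.map_tmul]
      refine add_mem ?_ ?_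
      · simpa using tmul_mem_gradeTensor (hπ.mem 0 v) (hρ.mem γ w)
      · simpa [hγ] using tmul_mem_gradeTensor (hπ.mem 1 v) (hρ.mem (γ + 1) w)
  · intro γ t ht
    induction ht using Submodule.span_induction with
    | zero => simp
    | add s t _ _ hs ht => rw [map_add, hs, ht]
    | smul c t _ ht => rw [map_smul, ht]
    | mem t ht =>
      obtain ⟨α, β, v, w, h, hv, hw, rfl⟩ := ht
      rw [hπ.map_tmul hρ γ α β hv hw, if_pos h]
  · intro γ δ hne t ht
    induction ht using Submodule.span_induction with
    | zero => simp
    | add s t _ _ hs ht => rw [map_add, hs, ht, add_zero]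
    | smul c t _ ht => rw [map_smul, ht, smul_zero]
    | mem t ht =>
      obtain ⟨α, β, v, w, h, hv, hw, rfl⟩ := ht
      rw [hπ.map_tmul hρ δ α β hv hw, if_neg (h ▸ hne)]
  · intro t
    have h11 : (1 : ZMod 2) + 1 = 0 := by decide
    induction t using TensorProduct.induction_on with
    | zero => simp
    | add s t hs ht => rw [map_add, map_add, add_add_add_comm, hs, ht]
    | tmul v w =>
      have : v ⊗ₜ[K] w = (π 0 v + π 1 v) ⊗ₜ[K] (ρ 0 w + ρ 1 w) := by rw [hπ.sum, hρ.sum]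
      refine Eq.trans ?_ this.symm
      simp only [LinearMap.add_apply, TensorProduct.map_tmul, zero_add, h11,
        TensorProduct.add_tmul, TensorProduct.tmul_add]
      abel

theorem IsGradingProj.quot {g : ZMod 2 → Submodule K V} {π : ZMod 2 → V →ₗ[K] V}
    (h : IsGradingProj g π) (S : Submodule K V) (hS : ∀ α, S ≤ S.comap (π α)) :
    IsGradingProj (gradeQuot g S) (fun α => S.mapQ S (π α) (hS α)) := by
  refine ⟨?_, ?_, ?_, ?_⟩
  · intro α v
    obtain ⟨v, rfl⟩ := S.mkQ_surjective v
    exact ⟨π α v, h.mem α v, by simp⟩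
  · rintro α _ ⟨v, hv, rfl⟩
    simp [h.fix α v hv]
  · rintro α β hne _ ⟨v, hv, rfl⟩
    simp [h.kill α β hne v hv]
  · intro v
    obtain ⟨v, rfl⟩ := S.mkQ_surjective v
    simpa using congrArg S.mkQ (h.sum v)

/-- A supermodule regarded as a Lie superalgebra with zero bracket. -/
def abelianLieSuperalgebra (g : ZMod 2 → Submodule K V) (hg : DirectSum.IsInternal g) :
    LieSuperalgebra K where
  carrier := V
  grading := g
  isInternal := hg
  bracket := 0
  bracket_grading := by simp
  super_skew := by simp
  super_jacobi := by simp
  bracket_self_even := by simp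

end Projections

section Relations

variable {P N : LieSuperalgebra K}

/-- The defining relator of `P ⊗ N` attached to `[x, y] ⊗ m`. -/
def actionRelator (a : LieSuperAction P N) (α β : ZMod 2) (x y : P.carrier) (m : N.carrier) :
    P.carrier ⊗[K] N.carrier :=
  -(ssign α β • (y ⊗ₜ[K] (a.act x m))) + x ⊗ₜ[K] (a.act y m) - (P.bracket x y) ⊗ₜ[K] m

theorem actionRelator_mem (a : LieSuperAction P N) {α β γ : ZMod 2} {x y : P.carrier}
    {m : N.carrier} (hx : x ∈ P.grading α) (hy : y ∈ P.grading β) (hm : m ∈ N.grading γ) :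
    actionRelator a α β x y m ∈ gradeTensor P.grading N.grading (α + β + γ) := by
  refine sub_mem (add_mem (neg_mem (zsmul_mem ?_ _)) ?_) ?_
  · have := tmul_mem_gradeTensor hy (a.act_grading α γ x m hx hm)
    rwa [← add_assoc, add_comm β α] at this
  · have := tmul_mem_gradeTensor hx (a.act_grading β γ y m hy hm)
    rwa [← add_assoc] at this
  · exact tmul_mem_gradeTensor (P.bracket_grading α β x y hx hy) hm

/-- A linear map out of `Λ²(P) ⊗ N` has values in `S` as soon as it does on homogeneous
elements. -/
theorem range_le_of_homogeneous {V : Type} [AddCommGroup V] [Module K V]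
    (d : ((P.carrier ⊗[K] P.carrier ⧸ altRel P) ⊗[K] N.carrier) →ₗ[K] V) (S : Submodule K V)
    (h : ∀ (α β γ : ZMod 2), ∀ x ∈ P.grading α, ∀ y ∈ P.grading β, ∀ m ∈ N.grading γ,
      d (((altRel P).mkQ (x ⊗ₜ[K] y)) ⊗ₜ[K] m) ∈ S) :
    LinearMap.range d ≤ S := by
  rintro _ ⟨t, rfl⟩
  induction t using TensorProduct.induction_on with
  | zero => simp
  | add s t hs ht => rw [map_add]; exact add_mem hs ht
  | tmul q m =>
    obtain ⟨q, rfl⟩ := (altRel P).mkQ_surjective q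
    induction q using TensorProduct.induction_on with
    | zero => simp
    | add s t hs ht => rw [map_add, TensorProduct.add_tmul, map_add]; exact add_mem hs ht
    | tmul x y =>
      induction x using homogeneous_induction P.isInternal with
      | add x x' hx hx' =>
        rw [TensorProduct.add_tmul, map_add, TensorProduct.add_tmul, map_add]
        exact add_mem hx hx'
      | hom α x hx =>
        induction y using homogeneous_induction P.isInternal with
        | add y y' hy hy' =>
          rw [TensorProduct.tmul_add, map_add, TensorProduct.add_tmul, map_add]
          exact add_mem hy hy'
        | hom β y hy =>
          induction m using homogeneous_induction N.isInternal with
          | add m m' hm hm' =>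
            rw [TensorProduct.tmul_add, map_add]
            exact add_mem hm hm'
          | hom γ m hm => exact h α β γ x hx y hy m hm

/-- Linear maps out of `P ⊗ N` agreeing on homogeneous tensors are equal. -/
theorem tensor_hom_ext {V : Type} [AddCommGroup V] [Module K V]
    {f g : P.carrier ⊗[K] N.carrier →ₗ[K] V}
    (h : ∀ (α β : ZMod 2), ∀ x ∈ P.grading α, ∀ m ∈ N.grading β,
      f (x ⊗ₜ[K] m) = g (x ⊗ₜ[K] m)) : f = g := by
  refine TensorProduct.ext' fun x m => ?_
  induction x using homogeneous_induction P.isInternal with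
  | add x x' hx hx' => rw [TensorProduct.add_tmul, map_add, map_add, hx, hx']
  | hom α x hx =>
    induction m using homogeneous_induction N.isInternal with
    | add m m' hm hm' => rw [TensorProduct.tmul_add, map_add, map_add, hm, hm']
    | hom β m hm => exact h α β x hx m hm

theorem isInternal_gradeQuot_of_relators (a : LieSuperAction P N)
    (d : ((P.carrier ⊗[K] P.carrier ⧸ altRel P) ⊗[K] N.carrier) →ₗ[K]
      (P.carrier ⊗[K] N.carrier))
    (hd : ∀ (α β : ZMod 2) (x : P.grading α) (y : P.grading β) (m : N.carrier),
      d (((altRel P).mkQ (x.1 ⊗ₜ[K] y.1)) ⊗ₜ[K] m) = actionRelator a α β x.1 y.1 m) :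
    DirectSum.IsInternal
      (gradeQuot (gradeTensor P.grading N.grading) (LinearMap.range d)) := by
  obtain ⟨π, hπ⟩ := exists_isGradingProj P.isInternal
  obtain ⟨ρ, hρ⟩ := exists_isGradingProj N.isInternal
  have hτ := hπ.tensor hρ
  refine (hτ.quot (LinearMap.range d) fun δ => ?_).isInternal
  refine range_le_of_homogeneous d _ fun α β γ x hx y hy m hm => ?_
  have hdeg := actionRelator_mem a hx hy hm
  have hr := hd α β ⟨x, hx⟩ ⟨y, hy⟩ m
  simp only at hr
  rw [Submodule.mem_comap, hr]
  by_cases h : α + β + γ = δ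
  · subst h
    rw [hτ.fix _ _ hdeg, ← hr]
    exact LinearMap.mem_range_self _ _
  · rw [hτ.kill _ _ h _ hdeg]
    exact zero_mem _

/-- The symbols `p ⊗ m` modulo the relators, when `N` is abelian and acts trivially on `P`. -/
def quotTensorData (aPN : LieSuperAction P N) (aNP : LieSuperAction N P)
    (hab : ∀ x y : N.carrier, N.bracket x y = 0) (htriv : aNP.act = 0)
    (S : Submodule K (P.carrier ⊗[K] N.carrier))
    (hS : DirectSum.IsInternal (gradeQuot (gradeTensor P.grading N.grading) S))
    (hrel : ∀ (α β : ZMod 2) (x : P.grading α) (y : P.grading β) (m : N.carrier),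
      actionRelator aPN α β x.1 y.1 m ∈ S) :
    TensorData aPN aNP (abelianLieSuperalgebra _ hS) where
  pair α β p m := S.mkQ (p.1 ⊗ₜ[K] m.1)
  pair_grading α β p m := ⟨p.1 ⊗ₜ[K] m.1, tmul_mem_gradeTensor p.2 m.2, rfl⟩
  pair_smul_left α β c p m :=
    (congrArg S.mkQ (TensorProduct.smul_tmul' c p.1 m.1).symm).trans (map_smul S.mkQ c _)
  pair_smul_right α β c p m :=
    (congrArg S.mkQ (TensorProduct.tmul_smul c p.1 m.1)).trans (map_smul S.mkQ c _)
  pair_add_left α β p p' m :=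
    (congrArg S.mkQ (TensorProduct.add_tmul p.1 p'.1 m.1)).trans (map_add S.mkQ _ _)
  pair_add_right α β p m m' :=
    (congrArg S.mkQ (TensorProduct.tmul_add p.1 m.1 m'.1)).trans (map_add S.mkQ _ _)
  pair_bracket_left α α' β p p' m := by
    have h := (Submodule.Quotient.mk_eq_zero S).2 (hrel α α' p p' m.1)
    change S.mkQ (actionRelator aPN α α' p.1 p'.1 m.1) = 0 at h
    rw [actionRelator, map_sub, map_add, map_neg, map_zsmul, sub_eq_zero] at h
    refine h.symm.trans ?_
    rw [neg_add_eq_sub]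
    rfl
  pair_bracket_right α β β' p m m' := by
    simp only [hab, htriv, LinearMap.zero_apply, TensorProduct.zero_tmul,
      TensorProduct.tmul_zero, map_zero]
    exact (by simp : (0 : (P.carrier ⊗[K] N.carrier) ⧸ S)
      = ssign β' (α + β) • 0 - ssign α β • 0)
  pair_bracket_pair α β α' β' p m p' m' := by
    simp only [htriv, LinearMap.zero_apply, TensorProduct.zero_tmul, map_zero]
    exact (by simp : (0 : (P.carrier ⊗[K] N.carrier) ⧸ S) = -(ssign α β • 0))

theorem TensorData.pair_zero_left {aPN : LieSuperAction P N} {aNP : LieSuperAction N P}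
    {T : LieSuperalgebra K} (ι : TensorData aPN aNP T) (α β : ZMod 2) (m : N.grading β) :
    ι.pair α β 0 m = 0 := by
  simpa using ι.pair_smul_left α β 0 0 m

end Relations

/-- Over a field `K`, for a `P`-supermodule `M` regarded as the crossed
`P`-module `(M, 0)`, the non-abelian homologies agree with the Chevalley–Eilenberg
homologies: `H̄₀(P,M) ≅ H₀(P,M)` and `H̄₁(P,M) ≅ H₁(P,M)` as super vector spaces. -/
theorem statement10 {K : Type} [Field K] (P Mod : LieSuperalgebra K)
    -- `Mod` is a `P`-supermodule: an abelian Lie superalgebra with an action of `P`,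
    (hab : ∀ x y : Mod.carrier, Mod.bracket x y = 0)
    (aPM : LieSuperAction P Mod)
    -- regarded as the crossed module `(Mod, 0)`, so `Mod` acts trivially on `P`
    (aMP : LieSuperAction Mod P) (htriv : aMP.act = 0)
    -- `(T, ι)` is the non-abelian tensor product `P ⊗ M`
    (T : LieSuperalgebra K) (ι : TensorData aPM aMP T) (hT : IsNATensor aPM aMP T ι)
    -- `ν : P ⊗ M → M`, `p ⊗ m ↦ ᵖm`
    (ν : LieSuperHom T Mod)
    (hν : ∀ (α β : ZMod 2) (p : P.grading α) (m : Mod.grading β),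
      ν.toLinear (ι.pair α β p m) = aPM.act p.1 m.1)
    -- the canonical map `P ⊗_K M → P ⊗ M`
    (canon : P.carrier ⊗[K] Mod.carrier →ₗ[K] T.carrier)
    (hcanon : ∀ (α β : ZMod 2) (p : P.grading α) (m : Mod.grading β),
      canon (p.1 ⊗ₜ[K] m.1) = ι.pair α β p m)
    -- the Chevalley–Eilenberg boundary maps `d₁ : P ⊗_K M → M` and
    -- `d₂ : Λ²_K(P) ⊗_K M → P ⊗_K M`
    (d₁ : P.carrier ⊗[K] Mod.carrier →ₗ[K] Mod.carrier)
    (hd₁ : ∀ (p : P.carrier) (m : Mod.carrier), d₁ (p ⊗ₜ[K] m) = -(aPM.act p m))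
    (d₂ : ((P.carrier ⊗[K] P.carrier ⧸ altRel P) ⊗[K] Mod.carrier) →ₗ[K]
          (P.carrier ⊗[K] Mod.carrier))
    (hd₂ : ∀ (α β : ZMod 2) (x : P.grading α) (y : P.grading β) (m : Mod.carrier),
      d₂ (((altRel P).mkQ (x.1 ⊗ₜ[K] y.1)) ⊗ₜ[K] m)
        = -(ssign α β • (y.1 ⊗ₜ[K] (aPM.act x.1 m))) + x.1 ⊗ₜ[K] (aPM.act y.1 m)
          - (P.bracket x.1 y.1) ⊗ₜ[K] m) :
    -- `H̄₀(P,M) ≅ H₀(P,M)`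
    (∃ e₀ : (Mod.carrier ⧸ LinearMap.range ν.toLinear) ≃ₗ[K]
        (Mod.carrier ⧸ LinearMap.range d₁),
      SuperEquiv (gradeQuot Mod.grading (LinearMap.range ν.toLinear))
        (gradeQuot Mod.grading (LinearMap.range d₁)) e₀ ∧
      ∀ m : Mod.carrier,
        e₀ ((LinearMap.range ν.toLinear).mkQ m) = (LinearMap.range d₁).mkQ m) ∧
    -- `H̄₁(P,M) ≅ H₁(P,M)`
    (∃ e₁ : (LinearMap.ker d₁ ⧸
          Submodule.comap (LinearMap.ker d₁).subtype (LinearMap.range d₂)) ≃ₗ[K]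
        LinearMap.ker ν.toLinear,
      SuperEquiv
        (gradeQuot (gradeSub (gradeTensor P.grading Mod.grading) (LinearMap.ker d₁))
          (Submodule.comap (LinearMap.ker d₁).subtype (LinearMap.range d₂)))
        (gradeSub T.grading (LinearMap.ker ν.toLinear)) e₁ ∧
      ∀ w : LinearMap.ker d₁,
        (e₁ (Submodule.Quotient.mk w) : T.carrier) = canon w.1) := by
  have hinj := isInternal_gradeQuot_of_relators aPM d₂ hd₂
  have hrel : ∀ (α β : ZMod 2) (x : P.grading α) (y : P.grading β) (m : Mod.carrier),
      actionRelator aPM α β x.1 y.1 m ∈ LinearMap.range d₂ :=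
    fun α β x y m => ⟨_, hd₂ α β x y m⟩
  let δ := quotTensorData aPM aMP hab htriv (LinearMap.range d₂) hinj hrel
  obtain ⟨f, hf, -⟩ := hT _ δ
  let F : T.carrier →ₗ[K] ((P.carrier ⊗[K] Mod.carrier) ⧸ LinearMap.range d₂) := f.toLinear
  have hF : ∀ (α : ZMod 2), ∀ t ∈ T.grading α,
      F t ∈ gradeQuot (gradeTensor P.grading Mod.grading) (LinearMap.range d₂) α :=
    f.map_grading
  -- `canon` is even and kills the boundaries
  have hcgr : ∀ (α : ZMod 2), ∀ t ∈ gradeTensor P.grading Mod.grading α,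
      canon t ∈ T.grading α := by
    intro α t ht
    refine (Submodule.span_le (p := (T.grading α).comap canon)).2 ?_ ht
    rintro _ ⟨β, γ, p, m, rfl, hp, hm, rfl⟩
    have h := hcanon β γ ⟨p, hp⟩ ⟨m, hm⟩
    change canon (p ⊗ₜ[K] m) ∈ T.grading (β + γ)
    exact h ▸ ι.pair_grading β γ _ _
  have hcker : LinearMap.range d₂ ≤ LinearMap.ker canon := by
    refine range_le_of_homogeneous d₂ _ fun α β γ x hx y hy m hm => ?_
    have h := hd₂ α β ⟨x, hx⟩ ⟨y, hy⟩ m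
    have h1 := hcanon β (α + γ) ⟨y, hy⟩ ⟨_, aPM.act_grading α γ x m hx hm⟩
    have h2 := hcanon α (β + γ) ⟨x, hx⟩ ⟨_, aPM.act_grading β γ y m hy hm⟩
    have h3 := hcanon (α + β) γ ⟨_, P.bracket_grading α β x y hx hy⟩ ⟨m, hm⟩
    have h4 := ι.pair_bracket_left α β γ ⟨x, hx⟩ ⟨y, hy⟩ ⟨m, hm⟩
    simp only at h h1 h2 h3 h4
    rw [LinearMap.mem_ker, h, map_sub, map_add, map_neg, map_zsmul, h1, h2, h3, h4]
    abel
  -- the bracket vanishes on the image of `canon`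
  have hbr : ∀ s t, T.bracket (canon s) (canon t) = 0 := by
    have h : (T.bracket.compl₁₂ canon canon) = 0 := by
      refine tensor_hom_ext fun α β p hp m hm => tensor_hom_ext fun α' β' p' hp' m' hm' => ?_
      have h1 := hcanon α β ⟨p, hp⟩ ⟨m, hm⟩
      have h2 := hcanon α' β' ⟨p', hp'⟩ ⟨m', hm'⟩
      simp only at h1 h2
      rw [LinearMap.compl₁₂_apply, h1, h2, ι.pair_bracket_pair]
      simp only [htriv, LinearMap.zero_apply]
      have h0 := ι.pair_zero_left (β + α) (α' + β')
        ⟨aPM.act p' m', aPM.act_grading α' β' p' m' hp' hm'⟩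
      change -(ssign α β • ι.pair (β + α) (α' + β') 0 _) = 0
      rw [h0, smul_zero, neg_zero]
    intro s t
    exact LinearMap.congr_fun (LinearMap.congr_fun h s) t
  let c : ((P.carrier ⊗[K] Mod.carrier) ⧸ LinearMap.range d₂) →ₗ[K] T.carrier :=
    (LinearMap.range d₂).liftQ canon hcker
  have hc : ∀ t, c ((LinearMap.range d₂).mkQ t) = canon t := fun t => rfl
  have hFcanon : ∀ t, F (canon t) = (LinearMap.range d₂).mkQ t := by
    have h : F ∘ₗ canon = (LinearMap.range d₂).mkQ := by
      refine tensor_hom_ext fun α β p hp m hm => ?_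
      have h1 := hcanon α β ⟨p, hp⟩ ⟨m, hm⟩
      simp only at h1
      rw [LinearMap.comp_apply, h1]
      exact hf α β _ _
    exact LinearMap.congr_fun h
  have hcF : ∀ t, c (F t) = t := by
    let φ : LieSuperHom T T :=
      { toLinear := c ∘ₗ F
        map_grading := by
          intro α t ht
          obtain ⟨w, hw, hwt⟩ := hF α t ht
          rw [LinearMap.comp_apply, ← hwt, hc]
          exact hcgr α w hw
        map_bracket := by
          intro s t
          obtain ⟨v, hv⟩ := (LinearMap.range d₂).mkQ_surjective (F s)
          obtain ⟨w, hw⟩ := (LinearMap.range d₂).mkQ_surjective (F t)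
          have h0 : F (T.bracket s t) = 0 := f.map_bracket s t
          rw [LinearMap.comp_apply, LinearMap.comp_apply, LinearMap.comp_apply, h0, map_zero,
            ← hv, ← hw, hc, hc, hbr] }
    let ψ : LieSuperHom T T :=
      { toLinear := LinearMap.id
        map_grading := fun _ _ h => h
        map_bracket := fun _ _ => rfl }
    have h : φ = ψ := (hT T ι).unique (fun α β p m => by
      change c (F (ι.pair α β p m)) = _
      rw [← hcanon, hFcanon, hc]) (fun α β p m => rfl)
    intro t
    exact LinearMap.congr_fun (congrArg LieSuperHom.toLinear h) t
  have hlift : ∀ (α : ZMod 2), ∀ t ∈ T.grading α,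
      ∃ w ∈ gradeTensor P.grading Mod.grading α, canon w = t := by
    intro α t ht
    obtain ⟨w, hw, hwt⟩ := hF α t ht
    exact ⟨w, hw, by rw [← hc, hwt, hcF]⟩
  have hsurj : ∀ t, ∃ w, canon w = t := by
    intro t
    obtain ⟨w, hw⟩ := (LinearMap.range d₂).mkQ_surjective (F t)
    exact ⟨w, by rw [← hc, hw, hcF]⟩
  have hker : ∀ w, canon w = 0 → w ∈ LinearMap.range d₂ := by
    intro w hw
    have h := hFcanon w
    rw [hw, map_zero] at h
    exact (Submodule.Quotient.mk_eq_zero _).1 h.symm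
  have hνd : ∀ w, ν.toLinear (canon w) = -d₁ w := by
    have h : ν.toLinear ∘ₗ canon = -d₁ := by
      refine tensor_hom_ext fun α β p hp m hm => ?_
      have h1 := hcanon α β ⟨p, hp⟩ ⟨m, hm⟩
      simp only at h1
      rw [LinearMap.comp_apply, h1, hν, LinearMap.neg_apply, hd₁, neg_neg]
    exact LinearMap.congr_fun h
  refine ⟨?_, ?_⟩
  · have hrange : LinearMap.range ν.toLinear = LinearMap.range d₁ := by
      ext m
      constructor
      · rintro ⟨t, rfl⟩
        obtain ⟨w, rfl⟩ := hsurj t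
        exact ⟨-w, by rw [hνd, map_neg]⟩
      · rintro ⟨w, rfl⟩
        exact ⟨canon (-w), by rw [hνd, map_neg, neg_neg]⟩
    refine ⟨Submodule.quotEquivOfEq _ _ hrange, ?_, fun m => rfl⟩
    intro α
    rw [gradeQuot, gradeQuot, ← Submodule.map_comp]
    rfl
  · have hmem : ∀ w : LinearMap.ker d₁, canon w.1 ∈ LinearMap.ker ν.toLinear := by
      intro w
      rw [LinearMap.mem_ker, hνd, LinearMap.mem_ker.1 w.2, neg_zero]
    let g : LinearMap.ker d₁ →ₗ[K] LinearMap.ker ν.toLinear :=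
      (canon ∘ₗ (LinearMap.ker d₁).subtype).codRestrict _ hmem
    have hg : ∀ w, (g w : T.carrier) = canon w.1 := fun w => rfl
    have hmem' : ∀ w, canon w ∈ LinearMap.ker ν.toLinear → w ∈ LinearMap.ker d₁ := by
      intro w hw
      rw [LinearMap.mem_ker, hνd, neg_eq_zero] at hw
      exact hw
    have hgsurj : Function.Surjective g := by
      rintro ⟨t, ht⟩
      obtain ⟨w, rfl⟩ := hsurj t
      exact ⟨⟨w, hmem' w ht⟩, rfl⟩
    have hgker : Submodule.comap (LinearMap.ker d₁).subtype (LinearMap.range d₂)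
        = LinearMap.ker g := by
      ext w
      rw [Submodule.mem_comap, LinearMap.mem_ker, ← Subtype.coe_inj, hg]
      exact ⟨fun h => hcker h, hker _⟩
    refine ⟨(Submodule.quotEquivOfEq _ _ hgker).trans (g.quotKerEquivOfSurjective hgsurj),
      ?_, fun w => rfl⟩
    intro α
    rw [gradeQuot, ← Submodule.map_comp]
    ext t
    constructor
    · rintro ⟨w, hw, rfl⟩
      exact hcgr α _ hw
    · intro ht
      obtain ⟨w, hw, hwt⟩ := hlift α t.1 ht
      exact ⟨⟨w, hmem' w (hwt ▸ t.2)⟩, hw, Subtype.ext hwt⟩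

end SuperNA
end

section
/- Let A be an associative superalgebra over a commutative unital ring K, regarded also as a Lie superalgebra with [a,b] = ab − (−1)^{|a||b|}ba, and let V(A) = (A ⊗_K A)/I(A) with bracket [a⊗b, a′⊗b′] = [a,b] ⊗ [a′,b′]. Then: (i) the formulas ᵃ(x⊗y) = a ⊗ [x,y] and ^{x⊗y}a = [[x,y],a] define compatible actions of the Lie superalgebras A and V(A) on each other; (ii) the map μ : V(A) → A, x ⊗ y ↦ [x,y], together with the action of A on V(A), is a crossed module of Lie superalgebras; (iii) the action of A on V(A) induces the trivial action of A on HC₁(A); (iv) there is a short exact sequence of crossed A-modules 0 → (HC₁(A),0) → (V(A),μ) → ([A,A], i) → 0, where i is the inclusion. -/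
open scoped TensorProduct

namespace SuperNA

variable {K : Type} [CommRing K]

/-- The graded submodule `I(A) ⊆ A ⊗_K A` of the cyclic relations. -/
def IA {K : Type} [CommRing K] (A : NuAssocSuperalgebra K) :
    Submodule K (A.carrier ⊗[K] A.carrier) :=
  Submodule.span K
    ({t | ∃ (α β : ZMod 2) (a : A.grading α) (b : A.grading β),
        t = a.1 ⊗ₜ[K] b.1 + ssign α β • (b.1 ⊗ₜ[K] a.1)} ∪
     {t | ∃ (α β γ : ZMod 2) (a : A.grading α) (b : A.grading β) (c : A.grading γ),
        t = (a.1 * b.1) ⊗ₜ[K] c.1 - a.1 ⊗ₜ[K] (b.1 * c.1)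
            + ssign γ (α + β) • ((c.1 * a.1) ⊗ₜ[K] b.1)})

/-- The graded submodule `J(A) ⊆ A ⊗_K A` of the Milnor relations, whose quotient is the
first Milnor cyclic homology `HC₁^M(A)`. -/
def JA {K : Type} [CommRing K] (A : NuAssocSuperalgebra K) :
    Submodule K (A.carrier ⊗[K] A.carrier) :=
  Submodule.span K
    ({t | ∃ (α β : ZMod 2) (a : A.grading α) (b : A.grading β),
        t = a.1 ⊗ₜ[K] b.1 + ssign α β • (b.1 ⊗ₜ[K] a.1)} ∪
     {t | ∃ (α β γ : ZMod 2) (a : A.grading α) (b : A.grading β) (c : A.grading γ),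
        t = (a.1 * b.1) ⊗ₜ[K] c.1 - a.1 ⊗ₜ[K] (b.1 * c.1)
            + ssign γ (α + β) • ((c.1 * a.1) ⊗ₜ[K] b.1)} ∪
     {t | ∃ (α β γ : ZMod 2) (a : A.grading α) (b : A.grading β) (c : A.grading γ),
        t = a.1 ⊗ₜ[K] (b.1 * c.1) - ssign β γ • (a.1 ⊗ₜ[K] (c.1 * b.1))})

/-- `[A,A]`: the graded submodule generated by the super-commutators. -/
def commSpan {K : Type} [CommRing K] (A : NuAssocSuperalgebra K) : Submodule K A.carrier :=
  Submodule.span K {x | ∃ (α β : ZMod 2) (a : A.grading α) (b : A.grading β),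
    x = a.1 * b.1 - ssign α β • (b.1 * a.1)}

/-- `[A,[A,A]]`. -/
def commSpan2 {K : Type} [CommRing K] (A : NuAssocSuperalgebra K)
    (brA : A.carrier →ₗ[K] A.carrier →ₗ[K] A.carrier) : Submodule K A.carrier :=
  Submodule.span K {x | ∃ (a : A.carrier), ∃ y ∈ commSpan A, x = brA a y}

/-- A unital associative superalgebra is in particular a possibly-non-unital one. -/
def AssocSuperalgebra.toNu {K : Type} [CommRing K] (A : AssocSuperalgebra K) :
    NuAssocSuperalgebra K where
  carrier := A.carrier
  grading := A.grading
  isInternal := A.isInternal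
  grading_mul := A.grading_mul

/-- Transport of graded pieces along a linear equivalence. -/
theorem mem_iff_of_map_eq {V W : Type} [AddCommGroup V] [Module K V] [AddCommGroup W]
    [Module K W] {e : V ≃ₗ[K] W} {S : Submodule K V} {T : Submodule K W}
    (h : S.map e.toLinearMap = T) (x : V) : x ∈ S ↔ e x ∈ T := by
  subst h
  simp

theorem ssign_comm (α β : ZMod 2) : ssign α β = ssign β α := by
  rw [ssign, ssign, mul_comm]

theorem ssign_add_right (α β γ : ZMod 2) : ssign α (β + γ) = ssign α β * ssign α γ := by
  revert α β γ
  decide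

theorem ssign_add_left (α β γ : ZMod 2) : ssign (α + β) γ = ssign α γ * ssign β γ := by
  rw [ssign_comm, ssign_add_right, ssign_comm γ, ssign_comm γ]

theorem ssign_eq_or (α β : ZMod 2) : ssign α β = 1 ∨ ssign α β = -1 :=
  neg_one_pow_eq_or ℤ _

/-- Induction on sums of homogeneous elements. -/
theorem induction_homogeneous {V : Type} [AddCommGroup V] [Module K V]
    {g : ZMod 2 → Submodule K V} (hg : DirectSum.IsInternal g) {p : V → Prop}
    (mem : ∀ α, ∀ x ∈ g α, p x) (zero : p 0) (add : ∀ x y, p x → p y → p (x + y)) (x : V) :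
    p x :=
  Submodule.iSup_induction g (motive := p) (hg.submodule_iSup_eq_top ▸ Submodule.mem_top) mem zero add

/-- The Leibniz rule `[a,b] ⊗ c = a ⊗ [b,c] - (-1)^(|a||b|) b ⊗ [a,c]` in `V(A)`. -/
theorem mkQ_bracket_tmul (A : NuAssocSuperalgebra K)
    (brA : A.carrier →ₗ[K] A.carrier →ₗ[K] A.carrier)
    (hbrA : ∀ (α β : ZMod 2) (a : A.grading α) (b : A.grading β),
      brA a.1 b.1 = a.1 * b.1 - ssign α β • (b.1 * a.1))
    {α β : ZMod 2} {a b : A.carrier} (ha : a ∈ A.grading α) (hb : b ∈ A.grading β)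
    (c : A.carrier) :
    (IA A).mkQ (brA a b ⊗ₜ[K] c)
      = (IA A).mkQ (a ⊗ₜ[K] brA b c) - ssign α β • (IA A).mkQ (b ⊗ₜ[K] brA a c) := by
  have skew {α β : ZMod 2} {a b : A.carrier} (ha : a ∈ A.grading α) (hb : b ∈ A.grading β) :
      (IA A).mkQ (a ⊗ₜ[K] b) = -(ssign α β • (IA A).mkQ (b ⊗ₜ[K] a)) := by
    rw [eq_neg_iff_add_eq_zero, ← map_zsmul, ← map_add]
    exact (Submodule.Quotient.mk_eq_zero _).2
      (Submodule.subset_span (Or.inl ⟨α, β, ⟨a, ha⟩, ⟨b, hb⟩, rfl⟩))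
  have cyc {α β γ : ZMod 2} {a b c : A.carrier} (ha : a ∈ A.grading α) (hb : b ∈ A.grading β)
      (hc : c ∈ A.grading γ) :
      (IA A).mkQ ((a * b) ⊗ₜ[K] c) = (IA A).mkQ (a ⊗ₜ[K] (b * c))
        - ssign γ (α + β) • (IA A).mkQ ((c * a) ⊗ₜ[K] b) := by
    rw [eq_sub_iff_add_eq, ← sub_eq_zero, ← map_zsmul, ← map_add, ← map_sub, add_sub_right_comm]
    exact (Submodule.Quotient.mk_eq_zero _).2
      (Submodule.subset_span (Or.inr ⟨α, β, γ, ⟨a, ha⟩, ⟨b, hb⟩, ⟨c, hc⟩, rfl⟩))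
  refine induction_homogeneous A.isInternal (p := fun c => (IA A).mkQ (brA a b ⊗ₜ[K] c)
      = (IA A).mkQ (a ⊗ₜ[K] brA b c) - ssign α β • (IA A).mkQ (b ⊗ₜ[K] brA a c))
    (fun γ c hc => ?_) (by simp) (fun x y hx hy => ?_) c
  · have h1 := hbrA α β ⟨a, ha⟩ ⟨b, hb⟩
    have h2 := hbrA β γ ⟨b, hb⟩ ⟨c, hc⟩
    have h3 := hbrA α γ ⟨a, ha⟩ ⟨c, hc⟩
    dsimp only at h1 h2 h3
    rw [h1, h2, h3]
    simp only [TensorProduct.sub_tmul, TensorProduct.tmul_sub, ← TensorProduct.smul_tmul', map_sub,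
      map_zsmul, TensorProduct.tmul_smul]
    rw [cyc ha hb hc, cyc hb ha hc, skew (A.grading_mul _ _ _ _ hc ha) hb,
      skew (A.grading_mul _ _ _ _ hc hb) ha]
    simp only [ssign_add_left, ssign_add_right, ssign_comm β α, ssign_comm γ α, ssign_comm γ β]
    rcases ssign_eq_or α β with h | h <;> rcases ssign_eq_or α γ with h' | h' <;>
      rcases ssign_eq_or β γ with h'' | h'' <;> simp only [h, h', h''] <;> module
  · simp only [TensorProduct.tmul_add, map_add, hx, hy]
    module

/-- For an associative superalgebra `A` regarded as a Lie superalgebra,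
and `V(A) = (A ⊗_K A)/I(A)`: (i) `ᵃ(x⊗y) = a ⊗ [x,y]` and `^{x⊗y}a = [[x,y],a]` define
compatible actions; (ii) `μ : V(A) → A`, `x ⊗ y ↦ [x,y]`, is a crossed module;
(iii) the action of `A` on `V(A)` induces the trivial action on `HC₁(A)`;
(iv) there is a short exact sequence of crossed `A`-modules
`0 → (HC₁(A),0) → (V(A),μ) → ([A,A],i) → 0`. -/
theorem statement12 {K : Type} [CommRing K] (A : NuAssocSuperalgebra K)
    -- the super-commutator bracket of `A`
    (brA : A.carrier →ₗ[K] A.carrier →ₗ[K] A.carrier)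
    (hbrA : ∀ (α β : ZMod 2) (a : A.grading α) (b : A.grading β),
      brA a.1 b.1 = a.1 * b.1 - ssign α β • (b.1 * a.1))
    -- `A` regarded as a Lie superalgebra
    (LA : LieSuperalgebra K) (eA : LA.carrier ≃ₗ[K] A.carrier)
    (hLAgr : ∀ γ : ZMod 2, (LA.grading γ).map eA.toLinearMap = A.grading γ)
    (hLAbr : ∀ x y : LA.carrier, eA (LA.bracket x y) = brA (eA x) (eA y))
    -- the linear map `A ⊗_K A → A`, `a ⊗ b ↦ [a,b]`
    (c : A.carrier ⊗[K] A.carrier →ₗ[K] A.carrier)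
    (hc : ∀ a b : A.carrier, c (a ⊗ₜ[K] b) = brA a b)
    -- `V(A) = (A ⊗_K A)/I(A)` with bracket `[a⊗b, a′⊗b′] = [a,b] ⊗ [a′,b′]`
    (VA : LieSuperalgebra K) (eV : VA.carrier ≃ₗ[K] (A.carrier ⊗[K] A.carrier ⧸ IA A))
    (hVgr : ∀ γ : ZMod 2, (VA.grading γ).map eV.toLinearMap
      = gradeQuot (gradeTensor A.grading A.grading) (IA A) γ)
    (hVbr : ∀ w w' : A.carrier ⊗[K] A.carrier,
      eV (VA.bracket (eV.symm ((IA A).mkQ w)) (eV.symm ((IA A).mkQ w')))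
        = (IA A).mkQ ((c w) ⊗ₜ[K] (c w')))
    -- the induced map `V(A) → A` whose kernel is `HC₁(A)`
    (cbar : (A.carrier ⊗[K] A.carrier ⧸ IA A) →ₗ[K] A.carrier)
    (hcbar : ∀ w : A.carrier ⊗[K] A.carrier, cbar ((IA A).mkQ w) = c w)
    -- `HC₁(A)` regarded as an abelian Lie superalgebra
    (HL : LieSuperalgebra K) (eH : HL.carrier ≃ₗ[K] LinearMap.ker cbar)
    (hHab : ∀ x y : HL.carrier, HL.bracket x y = 0)
    (hHgr : ∀ γ : ZMod 2, (HL.grading γ).map eH.toLinearMap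
      = gradeSub (gradeQuot (gradeTensor A.grading A.grading) (IA A)) (LinearMap.ker cbar) γ)
    -- `[A,A]` regarded as a Lie superalgebra
    (CA : LieSuperalgebra K) (eC : CA.carrier ≃ₗ[K] commSpan A)
    (hCgr : ∀ γ : ZMod 2, (CA.grading γ).map eC.toLinearMap
      = gradeSub A.grading (commSpan A) γ)
    (hCbr : ∀ x y : CA.carrier, ((eC (CA.bracket x y)) : A.carrier)
      = brA (eC x).1 (eC y).1) :
    ∃ (a1 : LieSuperAction LA VA) (a2 : LieSuperAction VA LA),
      -- (i) the two actions, given by `ᵃ(x⊗y) = a ⊗ [x,y]` and `^{x⊗y}a = [[x,y],a]`,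
      (∀ (x : LA.carrier) (w : A.carrier ⊗[K] A.carrier),
        a1.act x (eV.symm ((IA A).mkQ w)) = eV.symm ((IA A).mkQ ((eA x) ⊗ₜ[K] (c w)))) ∧
      (∀ (w : A.carrier ⊗[K] A.carrier) (x : LA.carrier),
        a2.act (eV.symm ((IA A).mkQ w)) x = eA.symm (brA (c w) (eA x))) ∧
      -- are compatible
      AreCompatible a1 a2 ∧
      -- (ii) `μ : V(A) → A`, `x ⊗ y ↦ [x,y]`, with the action `a1`, is a crossed module
      (∃ cmV : CrossedModule VA LA,
        cmV.act = a1 ∧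
        (∀ w : A.carrier ⊗[K] A.carrier,
          cmV.d.toLinear (eV.symm ((IA A).mkQ w)) = eA.symm (c w)) ∧
        -- (iii) the action of `A` on `V(A)` induces the trivial action on `HC₁(A)`
        (∀ (x : LA.carrier) (v : VA.carrier), cbar (eV v) = 0 → a1.act x v = 0) ∧
        -- (iv) the short exact sequence of crossed `A`-modules
        ∃ (cmH : CrossedModule HL LA) (cmC : CrossedModule CA LA)
          (fi : CMHom cmH cmV) (fp : CMHom cmV cmC),
          -- `(HC₁(A), 0)` with the trivial action
          cmH.d.toLinear = 0 ∧ cmH.act.act = 0 ∧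
          -- `([A,A], i)` with the inclusion and the action induced by the bracket
          (∀ y : CA.carrier, eA (cmC.d.toLinear y) = (eC y).1) ∧
          (∀ (x : LA.carrier) (y : CA.carrier),
            ((eC (cmC.act.act x y)) : A.carrier) = brA (eA x) (eC y).1) ∧
          -- the morphisms are the inclusion of `HC₁(A)` and the corestriction of `μ`
          (∀ v : HL.carrier, eV (fi.hom.toLinear v) = (eH v).1) ∧
          (∀ v : VA.carrier, ((eC (fp.hom.toLinear v)) : A.carrier) = cbar (eV v)) ∧
          -- exactness
          Function.Injective fi.hom.toLinear ∧
          LinearMap.range fi.hom.toLinear = LinearMap.ker fp.hom.toLinear ∧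
          Function.Surjective fp.hom.toLinear) := by
  have hμc (w : A.carrier ⊗[K] A.carrier) : cbar (eV (eV.symm ((IA A).mkQ w))) = c w := by
    rw [LinearEquiv.apply_symm_apply, hcbar]
  have hLA {α : ZMod 2} {x : LA.carrier} : x ∈ LA.grading α ↔ eA x ∈ A.grading α :=
    mem_iff_of_map_eq (hLAgr α) x
  have hbr_gr {α β : ZMod 2} {a b : A.carrier} (ha : a ∈ A.grading α) (hb : b ∈ A.grading β) :
      brA a b ∈ A.grading (α + β) := by
    rw [hbrA α β ⟨a, ha⟩ ⟨b, hb⟩]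
    refine Submodule.sub_mem _ (A.grading_mul _ _ _ _ ha hb) (zsmul_mem ?_ _)
    rw [add_comm]
    exact A.grading_mul _ _ _ _ hb ha
  have hcbar_gr {α : ZMod 2} {v : VA.carrier} (hv : v ∈ VA.grading α) :
      cbar (eV v) ∈ A.grading α := by
    obtain ⟨w, hw, hwv⟩ := (mem_iff_of_map_eq (hVgr α) v).1 hv
    rw [← hwv, hcbar]
    clear hwv
    induction hw using Submodule.span_induction with
    | mem t ht =>
      obtain ⟨β, γ, a, b, rfl, ha, hb, rfl⟩ := ht
      rw [hc]
      exact hbr_gr ha hb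
    | zero => simp
    | add x y _ _ hx hy => rw [map_add]; exact add_mem hx hy
    | smul r x _ hx => rw [map_smul]; exact Submodule.smul_mem _ _ hx
  have hc_mem (w : A.carrier ⊗[K] A.carrier) : c w ∈ commSpan A := by
    induction w with
    | zero => simp
    | add x y hx hy => rw [map_add]; exact add_mem hx hy
    | tmul a b =>
      rw [hc]
      refine induction_homogeneous A.isInternal (p := fun a => brA a b ∈ commSpan A)
        (fun α a ha => ?_) (by simp) (fun x y hx hy => ?_) a
      · refine induction_homogeneous A.isInternal (p := fun b => brA a b ∈ commSpan A)
          (fun β b hb => ?_) (by simp) (fun x y hx hy => ?_) b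
        · exact Submodule.subset_span ⟨α, β, ⟨a, ha⟩, ⟨b, hb⟩, hbrA α β ⟨a, ha⟩ ⟨b, hb⟩⟩
        · rw [map_add]; exact add_mem hx hy
      · rw [map_add, LinearMap.add_apply]; exact add_mem hx hy
  have hcbar_mem (q) : cbar q ∈ commSpan A := by
    obtain ⟨w, rfl⟩ := (IA A).mkQ_surjective q
    rw [hcbar]
    exact hc_mem w
  have hcomm_range : commSpan A ≤ LinearMap.range cbar := by
    refine Submodule.span_le.2 ?_
    rintro _ ⟨α, β, a, b, rfl⟩
    exact ⟨(IA A).mkQ (a.1 ⊗ₜ[K] b.1), by rw [hcbar, hc, hbrA]⟩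
  -- `μ : V(A) → A` and the symbol map `A × A → V(A)`, read in the given copies of `A` and `V(A)`
  obtain ⟨μ, hμ⟩ : ∃ μ : VA.carrier →ₗ[K] LA.carrier, ∀ v, eA (μ v) = cbar (eV v) :=
    ⟨eA.symm.toLinearMap ∘ₗ cbar ∘ₗ eV.toLinearMap, fun v => by simp⟩
  obtain ⟨T, hT⟩ : ∃ T : LA.carrier →ₗ[K] LA.carrier →ₗ[K] VA.carrier,
      ∀ x y, T x y = eV.symm ((IA A).mkQ (eA x ⊗ₜ[K] eA y)) :=
    ⟨((TensorProduct.mk K A.carrier A.carrier).compl₁₂ eA.toLinearMap eA.toLinearMap).compr₂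
      (eV.symm.toLinearMap ∘ₗ (IA A).mkQ), fun x y => by simp⟩
  have μ_T (x y : LA.carrier) : μ (T x y) = LA.bracket x y := by
    apply eA.injective
    rw [hμ, hT, hμc, hc, hLAbr]
  have bracket_V (v v' : VA.carrier) : VA.bracket v v' = T (μ v) (μ v') := by
    obtain ⟨w, hw⟩ := (IA A).mkQ_surjective (eV v)
    obtain ⟨w', hw'⟩ := (IA A).mkQ_surjective (eV v')
    apply eV.injective
    rw [hT, hμ, hμ, LinearEquiv.apply_symm_apply, ← hw, ← hw', hcbar, hcbar, ← hVbr, hw, hw',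
      LinearEquiv.symm_apply_apply, LinearEquiv.symm_apply_apply]
  have μ_bracket (v v' : VA.carrier) : μ (VA.bracket v v') = LA.bracket (μ v) (μ v') := by
    rw [bracket_V, μ_T]
  have μ_gr {α : ZMod 2} {v : VA.carrier} (hv : v ∈ VA.grading α) : μ v ∈ LA.grading α := by
    rw [hLA, hμ]
    exact hcbar_gr hv
  have T_gr {α β : ZMod 2} {x y : LA.carrier} (hx : x ∈ LA.grading α) (hy : y ∈ LA.grading β) :
      T x y ∈ VA.grading (α + β) := by
    rw [mem_iff_of_map_eq (hVgr _), hT, LinearEquiv.apply_symm_apply]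
    exact Submodule.mem_map_of_mem
      (Submodule.subset_span ⟨α, β, _, _, rfl, hLA.1 hx, hLA.1 hy, rfl⟩)
  have T_leibniz {α β : ZMod 2} {x y : LA.carrier} (hx : x ∈ LA.grading α)
      (hy : y ∈ LA.grading β) (z : LA.carrier) :
      T (LA.bracket x y) z = T x (LA.bracket y z) - ssign α β • T y (LA.bracket x z) := by
    simp only [hT, hLAbr]
    rw [mkQ_bracket_tmul A brA hbrA (hLA.1 hx) (hLA.1 hy), map_sub, map_zsmul]
  let a1 : LieSuperAction LA VA :=
    { act := T.compl₂ μ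
      act_grading := fun α β p m hp hm => T_gr hp (μ_gr hm)
      act_bracket := fun α β p p' hp hp' m => by
        simp only [LinearMap.compl₂_apply, μ_T]
        exact T_leibniz hp hp' _
      act_super_der := fun α β p m hp hm m' => by
        simp only [LinearMap.compl₂_apply, bracket_V, μ_T]
        rw [T_leibniz hp (μ_gr hm), sub_add_cancel] }
  let a2 : LieSuperAction VA LA :=
    { act := LA.bracket ∘ₗ μ
      act_grading := fun α β p m hp hm => LA.bracket_grading _ _ _ _ (μ_gr hp) hm
      act_bracket := fun α β p p' hp hp' m => by
        simp only [LinearMap.comp_apply, μ_bracket]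
        rw [LA.super_jacobi _ _ _ _ (μ_gr hp) (μ_gr hp'), add_sub_cancel_right]
      act_super_der := fun α β p m hp hm m' => LA.super_jacobi _ _ _ _ (μ_gr hp) hm m' }
  have a1_act (x v) : a1.act x v = T x (μ v) := rfl
  have a2_act (v x) : a2.act v x = LA.bracket (μ v) x := rfl
  let dV : LieSuperHom VA LA :=
    { toLinear := μ
      map_grading := fun α x hx => μ_gr hx
      map_bracket := μ_bracket }
  let cmV : CrossedModule VA LA :=
    { act := a1
      d := dV
      cm_act := fun p m => μ_T _ _
      cm_peiffer := fun m m' => (bracket_V m m').symm }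
  have hCA {α : ZMod 2} {x : CA.carrier} : x ∈ CA.grading α ↔ (eC x).1 ∈ A.grading α :=
    mem_iff_of_map_eq (hCgr α) x
  obtain ⟨i, hi⟩ : ∃ i : CA.carrier →ₗ[K] LA.carrier, ∀ y, eA (i y) = (eC y).1 :=
    ⟨eA.symm.toLinearMap ∘ₗ (commSpan A).subtype ∘ₗ eC.toLinearMap, fun v => by simp⟩
  have i_inj : Function.Injective i := fun x y h => by
    apply eC.injective
    apply Subtype.ext
    rw [← hi, ← hi, h]
  have i_gr {α : ZMod 2} {x : CA.carrier} : x ∈ CA.grading α ↔ i x ∈ LA.grading α := by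
    rw [hCA, hLA, hi]
  have i_bracket (x y : CA.carrier) : i (CA.bracket x y) = LA.bracket (i x) (i y) := by
    apply eA.injective
    rw [hi, hCbr, hLAbr, hi, hi]
  -- the corestriction of `μ` to `[A,A]`
  obtain ⟨π, hπ⟩ : ∃ π : VA.carrier →ₗ[K] CA.carrier, ∀ v, i (π v) = μ v :=
    ⟨eC.symm.toLinearMap ∘ₗ (cbar.codRestrict (commSpan A) hcbar_mem) ∘ₗ eV.toLinearMap,
      fun v => eA.injective (by simp [hi, hμ])⟩
  have i_act (x : LA.carrier) (y : CA.carrier) : i ((π ∘ₗ T x) (i y)) = LA.bracket x (i y) := by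
    rw [LinearMap.comp_apply, hπ, μ_T]
  let aC : LieSuperAction LA CA :=
    { act := (T.compr₂ π).compl₂ i
      act_grading := fun α β p m hp hm => by
        rw [i_gr] at hm ⊢
        exact (i_act p m).symm ▸ LA.bracket_grading _ _ _ _ hp hm
      act_bracket := fun α β p p' hp hp' m => by
        apply i_inj
        simp only [LinearMap.compl₂_apply, LinearMap.compr₂_apply, map_sub, map_zsmul, hπ, μ_T]
        rw [LA.super_jacobi _ _ _ _ hp hp', add_sub_cancel_right]
      act_super_der := fun α β p m hp hm m' => by
        apply i_inj
        simp only [LinearMap.compl₂_apply, LinearMap.compr₂_apply, map_add, map_zsmul, hπ, μ_T,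
          i_bracket]
        exact LA.super_jacobi _ _ _ _ hp (i_gr.1 hm) _ }
  have i_aC (x y) : i (aC.act x y) = LA.bracket x (i y) := i_act x y
  let cmC : CrossedModule CA LA :=
    { act := aC
      d :=
        { toLinear := i
          map_grading := fun α x hx => i_gr.1 hx
          map_bracket := i_bracket }
      cm_act := i_aC
      cm_peiffer := fun m m' => i_inj (by rw [i_aC, i_bracket]) }
  let cmH : CrossedModule HL LA :=
    { act :=
        { act := 0
          act_grading := fun _ _ _ _ _ _ => by simp
          act_bracket := fun _ _ _ _ _ _ _ => by simp
          act_super_der := fun _ _ _ _ _ _ _ => by simp }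
      d :=
        { toLinear := 0
          map_grading := fun _ _ _ => by simp
          map_bracket := fun _ _ => by simp }
      cm_act := fun _ _ => by simp
      cm_peiffer := fun m m' => by simp [hHab] }
  obtain ⟨j, hj⟩ : ∃ j : HL.carrier →ₗ[K] VA.carrier, ∀ v, eV (j v) = (eH v).1 :=
    ⟨eV.symm.toLinearMap ∘ₗ (LinearMap.ker cbar).subtype ∘ₗ eH.toLinearMap, fun v => by simp⟩
  have μ_j (v : HL.carrier) : μ (j v) = 0 := by
    apply eA.injective
    rw [hμ, hj, (eH v).2, map_zero]
  let fi : CMHom cmH cmV :=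
    { hom :=
        { toLinear := j
          map_grading := fun α x hx => by
            rw [mem_iff_of_map_eq (hVgr α), hj]
            exact (mem_iff_of_map_eq (hHgr α) x).1 hx
          map_bracket := fun x y => by rw [hHab, bracket_V, μ_j, μ_j, map_zero, map_zero] }
      equivariant := fun p m => by
        change j 0 = T p (μ (j m))
        rw [μ_j, map_zero, map_zero]
      comm := μ_j }
  let fp : CMHom cmV cmC :=
    { hom :=
        { toLinear := π
          map_grading := fun α x hx => by
            rw [i_gr, hπ]
            exact μ_gr hx
          map_bracket := fun x y => i_inj (by rw [hπ, μ_bracket, i_bracket, hπ, hπ]) }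
      equivariant := fun p m => i_inj (by
        change i (π (T p (μ m))) = i (aC.act p (π m))
        rw [hπ, μ_T, i_aC, hπ])
      comm := hπ }
  refine ⟨a1, a2, fun x w => ?_, fun w x => ?_, ⟨fun α β m n hm hn n' => ?_,
    fun α β m n hm hn m' => ?_⟩, cmV, rfl, fun w => ?_, fun x v hv => ?_, cmH, cmC, fi, fp, rfl,
    rfl, hi, fun x y => ?_, hj, fun v => ?_, fun x y h => ?_, ?_, fun y => ?_⟩
  · rw [a1_act, hT, hμ, hμc]
  · apply eA.injective
    rw [a2_act, hLAbr, hμ, hμc, LinearEquiv.apply_symm_apply]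
  · rw [a1_act, a2_act, a1_act, bracket_V, μ_T, LA.super_skew β α _ _ (μ_gr hn) hm,
      ssign_comm β α, map_neg, map_zsmul, LinearMap.neg_apply, LinearMap.smul_apply]
  · rw [a2_act, a1_act, a2_act, μ_T, LA.super_skew α β _ _ hm (μ_gr hn), map_neg, map_zsmul,
      LinearMap.neg_apply, LinearMap.smul_apply]
  · apply eA.injective
    change eA (μ _) = _
    rw [hμ, hμc, LinearEquiv.apply_symm_apply]
  · have : μ v = 0 := eA.injective (by rw [hμ, hv, map_zero])
    rw [a1_act, this, map_zero]
  · rw [← hi, ← hi, ← hLAbr]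
    exact congrArg eA (i_aC x y)
  · rw [← hi, ← hμ]
    exact congrArg eA (hπ v)
  · apply eH.injective
    apply Subtype.ext
    rw [← hj, ← hj]
    exact congrArg eV h
  · ext v
    constructor
    · rintro ⟨x, rfl⟩
      exact i_inj (by rw [map_zero]; exact (hπ _).trans (μ_j x))
    · intro hv
      have h0 : cbar (eV v) = 0 := by
        rw [← hμ, ← hπ, show π v = 0 from hv, map_zero, map_zero]
      refine ⟨eH.symm ⟨eV v, h0⟩, eV.injective ?_⟩
      exact (hj _).trans (by rw [LinearEquiv.apply_symm_apply])
  · obtain ⟨q, hq⟩ := hcomm_range (eC y).2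
    refine ⟨eV.symm q, i_inj (eA.injective ?_)⟩
    change eA (i (π _)) = _
    rw [hπ, hμ, LinearEquiv.apply_symm_apply, hq, hi]

end SuperNA
end
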